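/- arXiv:1706.02670 — 11 statements merged into one kernel-verified Lean document; each statement's English description precedes it below -/
import Mathlib

section
/- Let S be a completely regular semiring and write x° := x + x′. If x, y ∈ S satisfy x° = y°, then x + y = y + x. Consequently, for each a ∈ S the set H_a = {x ∈ S : x + x′ = a + a′} is closed under + and is an abelian group under +, with identity element a° = a + a′ and with the inverse of x given by x′. -/
/-- In a completely regular semiring (a semiring with a unary
operation `inv` satisfying the five listed identities, with `x° := x + inv x`),
if `x° = y°` then `x + y = y + x`; consequently, for each `a`, the set
`H_a = {x | x + inv x = a + inv a}` is closed under `+` and is an abelian group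
under `+` with identity `a + inv a` and inverse `inv x`. -/
theorem band_orthorings_stmt0
    {S : Type*} [Add S] [Mul S] (inv : S → S)
    (add_assoc : ∀ a b c : S, a + b + c = a + (b + c))
    (mul_assoc : ∀ a b c : S, a * b * c = a * (b * c))
    (left_distrib : ∀ a b c : S, a * (b + c) = a * b + a * c)
    (right_distrib : ∀ a b c : S, (a + b) * c = a * c + b * c)
    (cr1 : ∀ x : S, x + inv x + x = x)
    (cr2 : ∀ x : S, x + inv x = inv x + x)
    (cr3 : ∀ x : S, inv (inv x) = x)
    (cr4 : ∀ x y : S,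
      x + (y + inv y) + (x + inv x) + y = (x + inv x) + y + x + (y + inv y))
    (cr5 : ∀ x : S, x * (x + inv x) = x + inv x) :
    (∀ x y : S, x + inv x = y + inv y → x + y = y + x) ∧
    (∀ a : S,
      -- the identity element a° = a + inv a belongs to H_a
      ((a + inv a) + inv (a + inv a) = a + inv a) ∧
      -- H_a is closed under +
      (∀ x y : S, x + inv x = a + inv a → y + inv y = a + inv a →
        (x + y) + inv (x + y) = a + inv a) ∧
      -- a° is a two-sided identity element on H_a
      (∀ x : S, x + inv x = a + inv a →
        (a + inv a) + x = x ∧ x + (a + inv a) = x) ∧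
      -- inv x lies in H_a and is a two-sided inverse of x there
      (∀ x : S, x + inv x = a + inv a →
        inv x + inv (inv x) = a + inv a ∧
        x + inv x = a + inv a ∧ inv x + x = a + inv a) ∧
      -- addition is commutative on H_a
      (∀ x y : S, x + inv x = a + inv a → y + inv y = a + inv a →
        x + y = y + x)) := by
  have left_id : ∀ x, (x + inv x) + x = x := cr1
  have right_id : ∀ x, x + (x + inv x) = x := fun x => by
    rw [cr2, ← add_assoc, cr1]
  have comm : ∀ x y : S, x + inv x = y + inv y → x + y = y + x := fun x y h => by
    have h4 := cr4 x y
    rwa [← h, right_id, add_assoc x, h, left_id, add_assoc, ← h, right_id] at h4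
  have inv_circ : ∀ x, inv x + inv (inv x) = x + inv x := fun x => by
    rw [cr3, cr2]
  have circ_idem : ∀ x, (x + inv x) + (x + inv x) = x + inv x := fun x => by
    rw [← add_assoc, cr1]
  refine ⟨comm, fun a => ⟨?_, ?_, ?_, ?_, fun x y hx hy => comm x y (hx.trans hy.symm)⟩⟩
  · have h := cr1 (a + inv a)
    rwa [add_assoc, ← cr2 (a + inv a), ← add_assoc, circ_idem] at h
  · intro x y hx hy
    have hxy : inv x + inv (inv x) = y + inv y := by rw [inv_circ, hx, hy]
    have z_id : (x + y) + (a + inv a) = x + y := by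
      rw [← hy, add_assoc, right_id]
    have z_inv : (x + y) + (inv x + inv y) = a + inv a := by
      rw [add_assoc, ← add_assoc y, ← comm _ _ hxy, add_assoc, hy, ← add_assoc, hx, circ_idem]
    calc (x + y) + inv (x + y)
        = ((x + y) + inv (x + y)) + (a + inv a) := by
          rw [cr2, add_assoc (inv (x + y)), z_id]
      _ = ((x + y) + inv (x + y) + (x + y)) + (inv x + inv y) := by
          rw [add_assoc _ (x + y) (inv x + inv y), z_inv]
      _ = a + inv a := by rw [cr1, z_inv]
  · intro x hx
    exact ⟨hx ▸ left_id x, hx ▸ right_id x⟩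
  · intro x hx
    exact ⟨(inv_circ x).trans hx, hx, (cr2 x).symm.trans hx⟩
end

section
/- An idempotent semiring S satisfies the identity x + xyx + x = x if and only if it satisfies the identity xz + xyz + xz = xz. -/
/-- In an idempotent semigroup, every summand `b` of `a` satisfies `a + b + a = a`. -/
theorem add_add_self_eq_of_add_add_eq {S : Type*} [Add S]
    (add_assoc : ∀ a b c : S, a + b + c = a + (b + c)) (add_idem : ∀ a : S, a + a = a)
    {a b u v : S} (h : u + b + v = a) : a + b + a = a := by
  have hu : u + b + a = a := by rw [← h, ← add_assoc, add_idem]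
  calc a + b + a = u + ((b + a) + (b + a)) := by
        nth_rw 1 [← hu]
        simp only [add_assoc]
    _ = a := by rw [add_idem, ← add_assoc, hu]

/-- An idempotent semiring satisfies `x + xyx + x = x` iff it
satisfies `xz + xyz + xz = xz`. -/
theorem band_orthorings_stmt1
    {S : Type*} [Add S] [Mul S]
    (add_assoc : ∀ a b c : S, a + b + c = a + (b + c))
    (mul_assoc : ∀ a b c : S, a * b * c = a * (b * c))
    (left_distrib : ∀ a b c : S, a * (b + c) = a * b + a * c)
    (right_distrib : ∀ a b c : S, (a + b) * c = a * c + b * c)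
    (add_idem : ∀ a : S, a + a = a)
    (mul_idem : ∀ a : S, a * a = a) :
    (∀ x y : S, x + x * y * x + x = x) ↔
      (∀ x y z : S, x * z + x * y * z + x * z = x * z) := by
  have summand {a b u v : S} (h : u + b + v = a) : a + b + a = a :=
    add_add_self_eq_of_add_add_eq add_assoc add_idem h
  have trans {a b c : S} (hab : a + b + a = a) (hbc : b + c + b = b) : a + c + a = a := by
    refine summand (u := a + b) (v := b + a) ?_
    rw [← hbc] at hab
    simpa only [add_assoc] using hab
  have mul_compat {a b c d : S} (hab : a + b + a = a) (hcd : c + d + c = c) :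
      a * c + b * d + a * c = a * c :=
    trans (b := b * c) (by rw [← right_distrib, ← right_distrib, hab])
      (by rw [← left_distrib, ← left_distrib, hcd])
  refine ⟨fun h x y z => ?_, fun h x y => by simpa only [mul_idem] using h x y x⟩
  have hsum : (x + z) + x * y * z + (x + z) = x + z := by
    have hxz := h (x + z) y
    simp only [left_distrib, right_distrib] at hxz
    refine summand (u := x + z + (x * y * x + z * y * x)) (v := z * y * z + (x + z)) ?_
    simpa only [add_assoc] using hxz
  have hleft : (x + x * z) + x * y * z + (x + x * z) = x + x * z := by
    have := congrArg (x * ·) hsum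
    simpa only [left_distrib, ← mul_assoc, mul_idem] using this
  have hright : (x * z + z) + x * y * z + (x * z + z) = x * z + z := by
    have := congrArg (· * z) hsum
    simpa only [right_distrib, mul_assoc, mul_idem] using this
  have hprod : (x + x * z) * (x * z + z) = x * z := by
    rw [left_distrib, right_distrib, right_distrib, mul_idem, ← mul_assoc, mul_idem,
      mul_assoc, mul_idem, add_idem, add_idem]
  simpa only [hprod, mul_idem] using mul_compat hleft hright
end

section
/- An idempotent semiring S satisfies both identities x + xy + x = x and x + yx + x = x if and only if it satisfies the single identity x + yxy + x = x. (Idempotent semirings satisfying these identities are called band semirings.) -/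
/-- In an additive band, an element of the form `u + b + v` absorbs `b` from both sides. -/
theorem band_absorb_of_factor {S : Type*} [Add S]
    (add_assoc : ∀ a b c : S, a + b + c = a + (b + c))
    (add_idem : ∀ a : S, a + a = a) (u b v : S) :
    (u + b + v) + b + (u + b + v) = u + b + v := by
  have absorb : ∀ p q : S, p + (p + q) = p + q := fun p q => by rw [← add_assoc, add_idem]
  set x := u + b + v with hx
  have hfactor : x + b + (v + u + x) = x := by
    calc x + b + (v + u + x)
        = u + ((b + v) + ((b + v) + (u + (u + (b + v))))) := by simp only [hx, add_assoc]
      _ = (u + (b + v)) + (u + (b + v)) := by rw [absorb, absorb]; simp only [add_assoc]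
      _ = x := by rw [add_idem, hx, add_assoc]
  calc x + b + x = x + b + (x + b + (v + u + x)) := by rw [hfactor]
    _ = x + b + (v + u + x) := absorb _ _
    _ = x := hfactor

/-- An idempotent semiring satisfies both `x + xy + x = x` and
`x + yx + x = x` iff it satisfies `x + yxy + x = x` (band semirings). -/
theorem band_orthorings_stmt2
    {S : Type*} [Add S] [Mul S]
    (add_assoc : ∀ a b c : S, a + b + c = a + (b + c))
    (mul_assoc : ∀ a b c : S, a * b * c = a * (b * c))
    (left_distrib : ∀ a b c : S, a * (b + c) = a * b + a * c)
    (right_distrib : ∀ a b c : S, (a + b) * c = a * c + b * c)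
    (add_idem : ∀ a : S, a + a = a)
    (mul_idem : ∀ a : S, a * a = a) :
    ((∀ x y : S, x + x * y + x = x) ∧ (∀ x y : S, x + y * x + x = x)) ↔
      (∀ x y : S, x + y * x * y + x = x) := by
  constructor
  · rintro ⟨hr, hl⟩ x y
    have hx : x + x * y + y * x * y + (x * y + x) = x := by
      calc x + x * y + y * x * y + (x * y + x)
          = x + (x * y + y * (x * y) + x * y) + x := by simp only [add_assoc, mul_assoc]
        _ = x := by rw [hl, hr]
    have h := band_absorb_of_factor add_assoc add_idem (x + x * y) (y * x * y) (x * y + x)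
    rwa [hx] at h
  · intro h
    refine ⟨fun x y => ?_, fun x y => ?_⟩
    · have e : x * y * x * (x * y) = x * y := by
        rw [mul_assoc (x * y), ← mul_assoc x x y, mul_idem, mul_idem]
      simpa only [e] using h x (x * y)
    · have e : y * x * x * (y * x) = y * x := by
        rw [mul_assoc y x x, mul_idem, mul_idem]
      simpa only [e] using h x (y * x)
end

section
/- Let S be an idempotent semiring and let D⁺ be the relation defined by a D⁺ b iff a+b+a = a and b+a+b = b. Then D⁺ is the least distributive lattice congruence on S if and only if S satisfies the identities x + xy + x = x and x + yx + x = x (i.e., S is a band semiring). -/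
section

variable {S : Type*} [Add S] [Mul S]

/-- A congruence: an equivalence relation compatible with `+` and `*`. -/
def IsCongruence (ρ : S → S → Prop) : Prop :=
  Equivalence ρ ∧
    ∀ a b c d : S, ρ a b → ρ c d → ρ (a + c) (b + d) ∧ ρ (a * c) (b * d)

/-- A distributive lattice congruence: a congruence whose quotient is a
distributive lattice, i.e. `(a+b) ρ (b+a)`, `(ab) ρ (ba)` and `(a+ab) ρ a`. -/
def IsDLCongruence (ρ : S → S → Prop) : Prop :=
  IsCongruence ρ ∧ (∀ a b : S, ρ (a + b) (b + a)) ∧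
    (∀ a b : S, ρ (a * b) (b * a)) ∧ (∀ a b : S, ρ (a + a * b) a)

end

section AdditiveBand

variable {S : Type*} [Add S]

/-- In an additive band, every element of the form `u + z + v` absorbs `z`. -/
theorem band_absorb_of_eq (add_assoc : ∀ a b c : S, a + b + c = a + (b + c))
    (add_idem : ∀ a : S, a + a = a) {x u z v : S} (h : x = u + z + v) :
    x + z + x = x := by
  have hx : u + z + x = x := by rw [h, ← add_assoc, add_idem (u + z)]
  have hx' : u + (z + x) = x := by rw [← add_assoc, hx]
  calc x + z + x = u + (z + x) + (z + x) := by rw [hx', add_assoc]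
    _ = x := by rw [add_assoc u, add_idem, hx']

theorem band_absorb_trans (add_assoc : ∀ a b c : S, a + b + c = a + (b + c))
    (add_idem : ∀ a : S, a + a = a) {x y z : S} (hxy : x + y + x = x) (hyz : y + z + y = y) :
    x + z + x = x := by
  refine band_absorb_of_eq add_assoc add_idem (u := x + y) (v := y + x) ?_
  calc x = x + (y + z + y) + x := by rw [hyz, hxy]
    _ = x + y + z + (y + x) := by simp only [add_assoc]

theorem band_absorb_add (add_assoc : ∀ a b c : S, a + b + c = a + (b + c))
    (add_idem : ∀ a : S, a + a = a) {x b d : S} (hb : x + b + x = x) (hd : x + d + x = x) :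
    x + (b + d) + x = x := by
  have h₁ : x + (b + x + d) + x = x := by
    calc x + (b + x + d) + x = x + b + x + d + x := by simp only [add_assoc]
      _ = x := by rw [hb, hd]
  have h₂ : (b + x + d) + (d + b) + (b + x + d) = b + x + d := by
    refine band_absorb_of_eq add_assoc add_idem (u := b + x) (v := x + d) ?_
    calc b + x + d = (b + x + d) + (b + x + d) := (add_idem _).symm
      _ = b + x + (d + b) + (x + d) := by simp only [add_assoc]
  have h₃ : (d + b) + (b + d) + (d + b) = d + b := by
    refine band_absorb_of_eq add_assoc add_idem (u := d) (v := b) ?_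
    calc d + b = (d + b) + (d + b) := (add_idem _).symm
      _ = d + (b + d) + b := by simp only [add_assoc]
  exact band_absorb_trans add_assoc add_idem (band_absorb_trans add_assoc add_idem h₁ h₂) h₃

theorem band_absorb_add_add (add_assoc : ∀ a b c : S, a + b + c = a + (b + c))
    (add_idem : ∀ a : S, a + a = a) {a b c d : S} (hab : a + b + a = a) (hcd : c + d + c = c) :
    (a + c) + (b + d) + (a + c) = a + c := by
  refine band_absorb_add add_assoc add_idem ?_ ?_
  · refine band_absorb_of_eq add_assoc add_idem (u := a) (v := a + c) ?_
    rw [← add_assoc, hab]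
  · refine band_absorb_of_eq add_assoc add_idem (u := a + c) (v := c) ?_
    rw [add_assoc a c d, add_assoc a, hcd]

end AdditiveBand

/-- On an idempotent semiring, the relation
`a D⁺ b ↔ a+b+a = a ∧ b+a+b = b` is the least distributive lattice congruence
iff the identities `x + xy + x = x` and `x + yx + x = x` hold. -/
theorem band_orthorings_stmt3
    {S : Type*} [Add S] [Mul S]
    (add_assoc : ∀ a b c : S, a + b + c = a + (b + c))
    (mul_assoc : ∀ a b c : S, a * b * c = a * (b * c))
    (left_distrib : ∀ a b c : S, a * (b + c) = a * b + a * c)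
    (right_distrib : ∀ a b c : S, (a + b) * c = a * c + b * c)
    (add_idem : ∀ a : S, a + a = a)
    (mul_idem : ∀ a : S, a * a = a) :
    (IsDLCongruence (fun a b : S => a + b + a = a ∧ b + a + b = b) ∧
      ∀ ρ : S → S → Prop, IsDLCongruence ρ →
        ∀ a b : S, (a + b + a = a ∧ b + a + b = b) → ρ a b) ↔
    ((∀ x y : S, x + x * y + x = x) ∧ (∀ x y : S, x + y * x + x = x)) := by
  constructor
  · rintro ⟨⟨⟨heq, hcong⟩, -, hmul, habs⟩, -⟩
    have key : ∀ x z : S, x + (x + z) + x = x → x + z + x = x := fun x z h => by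
      rwa [← add_assoc, add_idem] at h
    refine ⟨fun x y => key x _ (habs x y).2, fun x y => key x _ ?_⟩
    · exact (heq.symm (heq.trans (hcong x x _ _ (heq.refl x) (hmul y x)).1 (habs x y))).1
  · rintro ⟨hr, hl⟩
    have trans : ∀ {x y z : S}, x + y + x = x → y + z + y = y → x + z + x = x :=
      band_absorb_trans add_assoc add_idem
    have refl : ∀ x : S, x + x + x = x := fun x => by rw [add_idem, add_idem]
    have mul : ∀ {a b c d : S}, a + b + a = a → c + d + c = c →
        a * c + b * d + a * c = a * c := fun {a b c d} hab hcd => by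
      refine trans (y := b * c) ?_ ?_
      · rw [← right_distrib, ← right_distrib, hab]
      · rw [← left_distrib, ← left_distrib, hcd]
    have add_comm_le : ∀ a b : S, a + b + (b + a) + (a + b) = a + b := fun a b =>
      band_absorb_add add_assoc add_idem
        (band_absorb_of_eq add_assoc add_idem (u := a) (v := b) (by rw [add_assoc, add_idem]))
        (band_absorb_of_eq add_assoc add_idem (u := a) (v := b) (by rw [add_idem]))
    have mul_comm_le : ∀ a b : S, a * b + b * a + a * b = a * b := fun a b => by
      have h := trans (hl (a * b) b) (hr (b * (a * b)) a)
      have e : b * (a * b) * a = b * a := by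
        rw [← mul_assoc b a b, mul_assoc (b * a) b a, mul_idem]
      rwa [e] at h
    refine ⟨⟨⟨⟨fun x => ⟨refl x, refl x⟩, fun h => ⟨h.2, h.1⟩,
      fun h k => ⟨trans h.1 k.1, trans k.2 h.2⟩⟩, fun a b c d h k =>
      ⟨⟨band_absorb_add_add add_assoc add_idem h.1 k.1,
        band_absorb_add_add add_assoc add_idem h.2 k.2⟩, mul h.1 k.1, mul h.2 k.2⟩⟩,
      fun a b => ⟨add_comm_le a b, add_comm_le b a⟩,
      fun a b => ⟨mul_comm_le a b, mul_comm_le b a⟩, fun a b => ⟨?_, ?_⟩⟩, ?_⟩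
    · rw [hr, ← add_assoc, add_idem]
    · rw [← add_assoc, add_idem, hr]
    · rintro ρ ⟨⟨heq, hcong⟩, hadd, -, -⟩ a b ⟨hab, hba⟩
      have h₁ : ρ a (a + b) := by
        have h := hadd (a + b) a
        rwa [hab, ← add_assoc, add_idem] at h
      have h₂ : ρ b (b + a) := by
        have h := hadd (b + a) b
        rwa [hba, ← add_assoc, add_idem] at h
      exact heq.trans h₁ (heq.trans (hadd a b) (heq.symm h₂))
end

section
/- Let S be an idempotent semiring, let R⁺ be the relation defined by a R⁺ b iff a+b = b and b+a = a, and let D· be the relation defined by a D· b iff aba = a and bab = b. Then S satisfies the identity x + xyx = x if and only if S satisfies the identity x + xyx + x = x and R⁺ ⊆ D·. -/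
/-- An idempotent semiring satisfies `x + xyx = x` iff it
satisfies `x + xyx + x = x` and `R⁺ ⊆ D·`, where `a R⁺ b ↔ a+b = b ∧ b+a = a`
and `a D· b ↔ aba = a ∧ bab = b`. -/
theorem band_orthorings_stmt4
    {S : Type*} [Add S] [Mul S]
    (add_assoc : ∀ a b c : S, a + b + c = a + (b + c))
    (mul_assoc : ∀ a b c : S, a * b * c = a * (b * c))
    (left_distrib : ∀ a b c : S, a * (b + c) = a * b + a * c)
    (right_distrib : ∀ a b c : S, (a + b) * c = a * c + b * c)
    (add_idem : ∀ a : S, a + a = a)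
    (mul_idem : ∀ a : S, a * a = a) :
    (∀ x y : S, x + x * y * x = x) ↔
      ((∀ x y : S, x + x * y * x + x = x) ∧
        ∀ a b : S, (a + b = b ∧ b + a = a) → (a * b * a = a ∧ b * a * b = b)) := by
  have sandwich (h : ∀ x y : S, x + x * y * x = x) (a b : S)
      (hab : a + b = b) : a * b * a = a := by
    have key : a + a * b * a = a * b * a := by
      have := congrArg (fun z => a * z * a) hab
      simpa only [left_distrib, right_distrib, mul_idem] using this
    rw [← key, h]
  constructor
  · intro h
    exact ⟨fun x y => by rw [h, add_idem],
      fun a b hab => ⟨sandwich h a b hab.1, sandwich h b a hab.2⟩⟩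
  · rintro ⟨h, hR⟩ x y
    have hx := (hR x (x + x * y * x) ⟨by rw [← add_assoc, add_idem], h x y⟩).1
    have absorb : x * (x * y * x) * x = x * y * x := by
      rw [mul_assoc x y x, ← mul_assoc x x, mul_idem, mul_assoc, mul_assoc, mul_idem]
    rwa [left_distrib, right_distrib, mul_idem, mul_idem, absorb] at hx
end

section
/- Let S be an idempotent semiring. Define the relations: a L⁺ b iff a+b = a and b+a = b; a R⁺ b iff a+b = b and b+a = a; a D· b iff aba = a and bab = b. Then the following conditions are equivalent: (1) L⁺ is the least distributive lattice congruence on S; (2) S satisfies x + xyx = x and D· ⊆ L⁺; (3) S satisfies x + xyx + x = x and R⁺ ⊆ D· ⊆ L⁺; (4) for all a,b ∈ S, b = a + b implies a = ab and a = ba; (5) S satisfies the identity x = (x+y)x(x+y); (6) S satisfies the identity x = x + yxy. -/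
section

variable {S : Type*} [Add S] [Mul S]

/-- `a L⁺ b ↔ a+b = a ∧ b+a = b`. -/
def Lplus (a b : S) : Prop := a + b = a ∧ b + a = b

/-- `a R⁺ b ↔ a+b = b ∧ b+a = a`. -/
def Rplus (a b : S) : Prop := a + b = b ∧ b + a = a

/-- `a D· b ↔ aba = a ∧ bab = b`. -/
def Dmul (a b : S) : Prop := a * b * a = a ∧ b * a * b = b

end

/-- For an idempotent semiring `S`, TFAE:
(1) `L⁺` is the least distributive lattice congruence on `S`;
(2) `S` satisfies `x + xyx = x` and `D· ⊆ L⁺`;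
(3) `S` satisfies `x + xyx + x = x` and `R⁺ ⊆ D· ⊆ L⁺`;
(4) `b = a + b` implies `a = ab` and `a = ba`;
(5) `S` satisfies `x = (x+y)x(x+y)`;
(6) `S` satisfies `x = x + yxy`. -/
theorem band_orthorings_stmt5
    {S : Type*} [Add S] [Mul S]
    (add_assoc : ∀ a b c : S, a + b + c = a + (b + c))
    (mul_assoc : ∀ a b c : S, a * b * c = a * (b * c))
    (left_distrib : ∀ a b c : S, a * (b + c) = a * b + a * c)
    (right_distrib : ∀ a b c : S, (a + b) * c = a * c + b * c)
    (add_idem : ∀ a : S, a + a = a)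
    (mul_idem : ∀ a : S, a * a = a) :
    [ IsDLCongruence (Lplus (S := S)) ∧
        (∀ ρ : S → S → Prop, IsDLCongruence ρ → ∀ a b : S, Lplus a b → ρ a b),
      (∀ x y : S, x + x * y * x = x) ∧ (∀ a b : S, Dmul a b → Lplus a b),
      (∀ x y : S, x + x * y * x + x = x) ∧ (∀ a b : S, Rplus a b → Dmul a b) ∧
        (∀ a b : S, Dmul a b → Lplus a b),
      ∀ a b : S, b = a + b → (a = a * b ∧ a = b * a),
      ∀ x y : S, x = (x + y) * x * (x + y),
      ∀ x y : S, x = x + y * x * y ].TFAE := by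
  have of_absorb (hr : ∀ x y : S, x + x * y = x) (hl : ∀ x y : S, x + y * x = x) (a b : S)
      (hab : b = a + b) : a = a * b ∧ a = b * a := by
    constructor
    · rw [hab, left_distrib, mul_idem, hr]
    · rw [hab, right_distrib, mul_idem, hl]
  have absorb_right (h : ∀ a b : S, b = a + b → (a = a * b ∧ a = b * a)) (x y : S) :
      x + x * y = x := by
    have := (h x (x + y) (by rw [← add_assoc, add_idem])).1
    rwa [left_distrib, mul_idem, eq_comm] at this
  have absorb_left (h : ∀ a b : S, b = a + b → (a = a * b ∧ a = b * a)) (x y : S) :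
      x + y * x = x := by
    have := (h x (x + y) (by rw [← add_assoc, add_idem])).2
    rwa [right_distrib, mul_idem, eq_comm] at this
  have absorb_conj (h : ∀ a b : S, b = a + b → (a = a * b ∧ a = b * a)) (x y : S) :
      x + y * x * y = x := by
    calc x + y * x * y = x + x * y + y * (x * y) := by rw [absorb_right h, mul_assoc]
      _ = x := by rw [add_assoc, absorb_left h, absorb_right h]
  have left_regular (h : ∀ a b : S, b = a + b → (a = a * b ∧ a = b * a)) (a b : S) :
      a + b + a = a + b := by
    calc a + b + a = a + b + (a + a * b) := by rw [absorb_right h]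
      _ = a + b + a * (a + b) := by rw [left_distrib, mul_idem]
      _ = a + b := absorb_left h _ _
  tfae_have 4 → 1 := by
    intro h
    refine ⟨⟨⟨⟨fun a => ⟨add_idem a, add_idem a⟩, fun hab => ⟨hab.2, hab.1⟩, ?_⟩, ?_⟩,
      ?_, ?_, ?_⟩, ?_⟩
    · rintro a b c ⟨hab, hba⟩ ⟨hbc, hcb⟩
      exact ⟨by rw [← hab, add_assoc, hbc], by rw [← hcb, add_assoc, hba]⟩
    · have add_compat (a b c d : S) (hab : a + b = a) (hcd : c + d = c) :
          a + c + (b + d) = a + c := by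
        calc a + c + (b + d) = a + b + c + (b + d) := by rw [hab]
          _ = a + (b + c + b) + d := by simp only [add_assoc]
          _ = a + b + (c + d) := by rw [left_regular h]; simp only [add_assoc]
          _ = a + c := by rw [hab, hcd]
      have mul_compat (a b c d : S) (hab : a + b = a) (hcd : c + d = c) :
          a * c + b * d = a * c := by
        have hbd : a * c + b * c = a * c := by rw [← right_distrib, hab]
        calc a * c + b * d = a * c + b * c + b * d := by rw [hbd]
          _ = a * c := by rw [add_assoc, ← left_distrib, hcd, hbd]
      rintro a b c d ⟨hab, hba⟩ ⟨hcd, hdc⟩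
      exact ⟨⟨add_compat a b c d hab hcd, add_compat b a d c hba hdc⟩,
        ⟨mul_compat a b c d hab hcd, mul_compat b a d c hba hdc⟩⟩
    · have add_swap (a b : S) : a + b + (b + a) = a + b := by
        rw [← add_assoc, add_assoc a b b, add_idem, left_regular h]
      exact fun a b => ⟨add_swap a b, add_swap b a⟩
    · have mul_swap (a b : S) : a * b + b * a = a * b := by
        calc a * b + b * a = a * b + b * (a * b) + b * a := by rw [absorb_left h]
          _ = a * b + (b * (a * b) + b * (a * b) * a) := by
            rw [add_assoc, mul_assoc b (a * b) a, mul_assoc a b a, ← mul_assoc b a (b * a),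
              mul_idem]
          _ = a * b := by rw [absorb_right h, absorb_left h]
      exact fun a b => ⟨mul_swap a b, mul_swap b a⟩
    · intro a b
      rw [absorb_right h]
      exact ⟨add_idem a, add_idem a⟩
    · intro ρ hρ a b hab
      simpa only [hab.1, hab.2] using hρ.2.1 a b
  tfae_have 1 → 4 := by
    rintro ⟨⟨⟨⟨hrefl, -, -⟩, hcongr⟩, -, hcomm, habs⟩, -⟩
    have hr (x y : S) : x + x * y = x := by
      simpa only [← add_assoc, add_idem] using (habs x y).2
    refine of_absorb hr fun x y => ?_
    have := (hcongr x x (x * y) (y * x) (hrefl x) (hcomm x y)).1.1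
    simpa only [hr, ← add_assoc, add_idem] using this
  tfae_have 4 → 2 := by
    refine fun h => ⟨fun x y => by rw [mul_assoc, absorb_right h], ?_⟩
    rintro a b ⟨hab, hba⟩
    constructor
    · simpa only [hba] using absorb_conj h a b
    · simpa only [hab] using absorb_conj h b a
  tfae_have 2 → 4 := by
    rintro ⟨h, hD⟩
    have mul_self_mul (a b : S) : a * (a * b) = a * b := by rw [← mul_assoc, mul_idem]
    have sandwich (a b : S) : a * (b * (a * b)) = a * b := by rw [← mul_assoc, mul_idem]
    refine of_absorb (fun x y => ?_) fun x y => ?_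
    · have hxy : x * y * x + x * y = x * y * x := by
        refine (hD _ _ ⟨?_, ?_⟩).1 <;> simp only [mul_assoc, mul_self_mul, sandwich]
      calc x + x * y = x + x * y * x + x * y := by rw [h]
        _ = x := by rw [add_assoc, hxy, h]
    · have hyx : x * y * x + y * x = x * y * x := by
        refine (hD _ _ ⟨?_, ?_⟩).1 <;> simp only [mul_assoc, mul_self_mul, sandwich]
      calc x + y * x = x + x * y * x + y * x := by rw [h]
        _ = x := by rw [add_assoc, hyx, h]
  tfae_have 4 → 3 := by
    intro h
    refine ⟨fun x y => by rw [mul_assoc, absorb_right h, add_idem], ?_, (tfae_4_to_2 h).2⟩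
    rintro a b ⟨hab, hba⟩
    obtain rfl : a = b := by
      have := left_regular h b a
      rw [add_assoc, hab, add_idem, hba] at this
      exact this.symm
    exact ⟨by rw [mul_idem, mul_idem], by rw [mul_idem, mul_idem]⟩
  tfae_have 3 → 2 := by
    rintro ⟨h, hRD, hDL⟩
    refine ⟨fun x y => ?_, hDL⟩
    have hR : Rplus (x + x * y * x) (x + x * y * x + x) :=
      ⟨by rw [← add_assoc, add_idem], by rw [add_assoc, ← add_assoc x x, add_idem, add_idem]⟩
    rw [← (hDL _ _ (hRD _ _ hR)).1, hR.1, h]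
  tfae_have 4 → 5 := by
    intro h x y
    obtain ⟨h₁, h₂⟩ := h x (x + y) (by rw [← add_assoc, add_idem])
    rw [← h₂, ← h₁]
  tfae_have 5 → 6 := by
    intro h x y
    refine (absorb_conj (fun a b hab => ?_) x y).symm
    have ha : a = b * a * b := by simpa only [← hab] using h a b
    constructor
    · conv_rhs => rw [ha, mul_assoc, mul_idem, ← ha]
    · conv_rhs => rw [ha, ← mul_assoc, ← mul_assoc, mul_idem, ← ha]
  tfae_have 6 → 4 := by
    intro h
    have hxy (x y : S) : x * y + y * x * y = x * y := by
      simpa only [mul_assoc, mul_idem] using (h (x * y) y).symm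
    have hyx (x y : S) : y * x + y * x * y = y * x := by
      simpa only [← mul_assoc, mul_idem] using (h (y * x) y).symm
    have expand₁ (x y : S) : x + (y * x + x * y) = x := by
      have := h x (x + y)
      rw [right_distrib, mul_idem, left_distrib, right_distrib, right_distrib, mul_idem,
        mul_assoc y x x, mul_idem, hxy, ← add_assoc, ← add_assoc, add_idem, add_assoc] at this
      exact this.symm
    have expand₂ (x y : S) : x + (x * y + y * x) = x := by
      have := h x (x + y)
      rw [mul_assoc, left_distrib, mul_idem, right_distrib, left_distrib, left_distrib, mul_idem,
        ← mul_assoc x x y, mul_idem, ← mul_assoc y x y, hyx, ← add_assoc, ← add_assoc, add_idem, add_assoc] at this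
      exact this.symm
    refine of_absorb (fun x y => ?_) fun x y => ?_
    · calc x + x * y = x + (y * x + x * y) + x * y := by rw [expand₁]
        _ = x := by rw [add_assoc, add_assoc, add_idem, expand₁]
    · calc x + y * x = x + (x * y + y * x) + y * x := by rw [expand₂]
        _ = x := by rw [add_assoc, add_assoc, add_idem, expand₂]
  tfae_finish
end

section
/- Let S be an idempotent semiring. Define the relations: a L⁺ b iff a+b = a and b+a = b; a R⁺ b iff a+b = b and b+a = a; a D· b iff aba = a and bab = b. Then the following conditions are equivalent: (1) R⁺ is the least distributive lattice congruence on S; (2) S satisfies xyx + x = x and D· ⊆ R⁺; (3) S satisfies x + xyx + x = x and L⁺ ⊆ D· ⊆ R⁺; (4) for all a,b ∈ S, b = b + a implies a = ab and a = ba; (5) S satisfies the identity x = (y+x)x(y+x); (6) S satisfies the identity x = yxy + x. -/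
/-- For an idempotent semiring `S`, TFAE:
(1) `R⁺` is the least distributive lattice congruence on `S`;
(2) `S` satisfies `xyx + x = x` and `D· ⊆ R⁺`;
(3) `S` satisfies `x + xyx + x = x` and `L⁺ ⊆ D· ⊆ R⁺`;
(4) `b = b + a` implies `a = ab` and `a = ba`;
(5) `S` satisfies `x = (y+x)x(y+x)`;
(6) `S` satisfies `x = yxy + x`. -/
theorem band_orthorings_stmt6
    {S : Type*} [Add S] [Mul S]
    (add_assoc : ∀ a b c : S, a + b + c = a + (b + c))
    (mul_assoc : ∀ a b c : S, a * b * c = a * (b * c))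
    (left_distrib : ∀ a b c : S, a * (b + c) = a * b + a * c)
    (right_distrib : ∀ a b c : S, (a + b) * c = a * c + b * c)
    (add_idem : ∀ a : S, a + a = a)
    (mul_idem : ∀ a : S, a * a = a) :
    [ IsDLCongruence (Rplus (S := S)) ∧
        (∀ ρ : S → S → Prop, IsDLCongruence ρ → ∀ a b : S, Rplus a b → ρ a b),
      (∀ x y : S, x * y * x + x = x) ∧ (∀ a b : S, Dmul a b → Rplus a b),
      (∀ x y : S, x + x * y * x + x = x) ∧ (∀ a b : S, Lplus a b → Dmul a b) ∧
        (∀ a b : S, Dmul a b → Rplus a b),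
      ∀ a b : S, b = b + a → (a = a * b ∧ a = b * a),
      ∀ x y : S, x = (y + x) * x * (y + x),
      ∀ x y : S, x = y * x * y + x ].TFAE := by
  have absorb_mul (h : ∀ x y : S, x = y * x * y + x) (a b : S) :
      a * b + a = a ∧ b * a + a = a := by
    constructor
    · have e : a * b * a * (a * b) = a * b := by
        rw [mul_assoc (a * b) a (a * b), ← mul_assoc a a b, mul_idem, mul_idem]
      have := h a (a * b)
      rw [e] at this
      exact this.symm
    · have e : b * a * a * (b * a) = b * a := by
        rw [mul_assoc b a a, mul_idem, mul_idem]
      have := h a (b * a)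
      rw [e] at this
      exact this.symm
  have right_regular (h : ∀ x y : S, x = y * x * y + x) (a b : S) : a + b + a = b + a := by
    have e := h (b + a) a
    rw [left_distrib, mul_idem, right_distrib, mul_idem, add_assoc, mul_assoc,
      ← add_assoc a b a] at e
    have e' : a * (b * a) + (a + b + a) = a + b + a := by
      rw [add_assoc a b a, ← add_assoc, (absorb_mul h a (b * a)).1]
    exact (e.trans e').symm
  tfae_have 1 → 6 := by
    rintro ⟨⟨⟨hE, hC⟩, hadd, hmul, habs⟩, -⟩ x y
    have hyx : Rplus (y * x * y) (x * y) := by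
      have := (hC _ _ _ _ (hmul y x) (hE.refl y)).2
      rwa [mul_assoc x y y, mul_idem] at this
    have hx : Rplus (y * x * y + x) x :=
      hE.trans (hC _ _ _ _ hyx (hE.refl x)).1 (hE.trans (hadd _ _) (habs x y))
    have := hx.1
    rw [add_assoc, add_idem] at this
    exact this.symm
  tfae_have 6 → 1 := by
    intro h
    have rr := right_regular h
    refine ⟨⟨⟨⟨fun a => ⟨add_idem a, add_idem a⟩, fun h => ⟨h.2, h.1⟩, ?_⟩, ?_⟩, ?_, ?_, ?_⟩, ?_⟩
    · rintro a b c ⟨h1, h2⟩ ⟨h3, h4⟩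
      exact ⟨by rw [← h3, ← add_assoc, h1], by rw [← h2, ← add_assoc, h4]⟩
    · have key : ∀ a b c d : S, a + b = b → c + d = d → a + c + (b + d) = b + d := by
        intro a b c d h1 h2
        calc a + c + (b + d) = a + c + (a + b + (c + d)) := by rw [h1, h2]
          _ = a + c + a + b + (c + d) := by simp only [add_assoc]
          _ = c + (a + b) + c + d := by rw [rr a c]; simp only [add_assoc]
          _ = a + b + (c + d) := by rw [rr c (a + b)]; simp only [add_assoc]
          _ = b + d := by rw [h1, h2]
      have keym : ∀ a b c d : S, a + b = b → b + a = a → c + d = d → d + c = c →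
          a * c + b * d = b * d := by
        intro a b c d h1 h2 h3 h4
        have e1 : a * c + b * c = b * c := by rw [← right_distrib, h1]
        have e2 : b * c + b * d = b * d := by rw [← left_distrib, h3]
        rw [← e2, ← add_assoc, e1]
      rintro a b c d ⟨h1, h2⟩ ⟨h3, h4⟩
      exact ⟨⟨key a b c d h1 h3, key b a d c h2 h4⟩,
        ⟨keym a b c d h1 h2 h3 h4, keym b a d c h2 h1 h4 h3⟩⟩
    · have key : ∀ a b : S, a + b + (b + a) = b + a := by
        intro a b
        rw [add_assoc, ← add_assoc b b a, add_idem, ← add_assoc, rr]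
      exact fun a b => ⟨key a b, key b a⟩
    · have key : ∀ a b : S, a * b + b * a = b * a := by
        intro a b
        have e : a * b * (b * a) * (a * b) = a * b := by
          calc a * b * (b * a) * (a * b) = a * (b * b) * (a * a) * b := by
                simp only [mul_assoc]
            _ = a * b * (a * b) := by rw [mul_idem, mul_idem]; simp only [mul_assoc]
            _ = a * b := mul_idem _
        have := h (b * a) (a * b)
        rw [e] at this
        exact this.symm
      exact fun a b => ⟨key a b, key b a⟩
    · intro a b
      exact ⟨by rw [add_assoc, (absorb_mul h a b).1, add_idem], by rw [← add_assoc, add_idem]⟩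
    · rintro ρ ⟨-, hadd, -, -⟩ a b ⟨h1, h2⟩
      have := hadd b a
      rwa [h1, h2] at this
  tfae_have 6 → 2 := by
    intro h
    refine ⟨fun x y => by rw [mul_assoc]; exact (absorb_mul h x (y * x)).1, ?_⟩
    rintro a b ⟨h1, h2⟩
    have e1 := h b a
    have e2 := h a b
    rw [h1] at e1
    rw [h2] at e2
    exact ⟨e1.symm, e2.symm⟩
  tfae_have 2 → 6 := by
    rintro ⟨h, hD⟩ x y
    have key : ∀ x y : S, x * y * x * (y * x * y) * (x * y * x) = x * y * x := by
      intro x y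
      calc x * y * x * (y * x * y) * (x * y * x)
          = x * y * (x * y) * (x * y) * (x * y) * x := by
            simp only [mul_assoc]
        _ = x * y * x := by simp only [mul_idem]
    have e := (hD _ _ ⟨key y x, key x y⟩).1
    calc x = x * y * x + x := (h x y).symm
      _ = y * x * y + (x * y * x + x) := by rw [← add_assoc, e]
      _ = y * x * y + x := by rw [h]
  tfae_have 6 → 3 := by
    intro h
    have h2 := tfae_6_to_2 h
    refine ⟨fun x y => by rw [add_assoc, h2.1, add_idem], ?_, h2.2⟩
    rintro a b ⟨h3, h4⟩
    have e := right_regular h a b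
    rw [h3, add_idem, h4] at e
    subst e
    exact ⟨by rw [mul_idem, mul_idem], by rw [mul_idem, mul_idem]⟩
  tfae_have 3 → 2 := by
    rintro ⟨h, hL, hD⟩
    refine ⟨fun x y => ?_, hD⟩
    have hx : x + (x * y * x + x) = x := by rw [← add_assoc, h]
    have e := hD _ _ (hL x (x * y * x + x) ⟨hx, by rw [add_assoc, add_idem]⟩)
    exact e.1.symm.trans hx
  tfae_have 6 → 4 := by
    intro h a b hb
    constructor
    · have e : a * b = a * b + a := by
        conv_lhs => rw [hb, left_distrib, mul_idem]
      rw [e, (absorb_mul h a b).1]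
    · have e : b * a = b * a + a := by
        conv_lhs => rw [hb, right_distrib, mul_idem]
      rw [e, (absorb_mul h a b).2]
  tfae_have 4 → 5 := by
    intro h x y
    obtain ⟨h1, h2⟩ := h x (y + x) (by rw [add_assoc, add_idem])
    rw [← h2, ← h1]
  tfae_have 5 → 6 := by
    intro h x y
    have e : x = y * x * y + (x * y + (y * x + x)) := by
      have := h x y
      rw [right_distrib, mul_idem, left_distrib, right_distrib, right_distrib, mul_idem,
        mul_assoc y x x, mul_idem, add_assoc] at this
      exact this
    calc x = y * x * y + (x * y + (y * x + x)) := e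
      _ = y * x * y + (y * x * y + (x * y + (y * x + x))) := by
        rw [← add_assoc (y * x * y) (y * x * y), add_idem]
      _ = y * x * y + x := by rw [← e]
  tfae_finish
end

section
/- An idempotent semiring S is a band semiring (satisfies x + yxy + x = x) if and only if S is a spined product of a left band semiring and a right band semiring with respect to a distributive lattice; that is, if and only if there exist an idempotent semiring S₁ satisfying x = x + yxy, an idempotent semiring S₂ satisfying x = yxy + x, a distributive lattice T (an idempotent semiring with commutative + and · satisfying a + ab = a), surjective homomorphisms φ₁ : S₁ → T and φ₂ : S₂ → T, and a bijection from S onto {(a,b) ∈ S₁ × S₂ : φ₁(a) = φ₂(b)} preserving + and ·. -/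
universe u

/-- A bundled semiring in the sense of this paper: two semigroup operations
with the two distributive laws (no commutativity, no identity elements). -/
structure RawSemiring : Type (u + 1) where
  carrier : Type u
  add : carrier → carrier → carrier
  mul : carrier → carrier → carrier
  add_assoc : ∀ a b c, add (add a b) c = add a (add b c)
  mul_assoc : ∀ a b c, mul (mul a b) c = mul a (mul b c)
  left_distrib : ∀ a b c, mul a (add b c) = add (mul a b) (mul a c)
  right_distrib : ∀ a b c, mul (add a b) c = add (mul a c) (mul b c)

/-- An idempotent (raw) semiring: `x + x = x` and `x · x = x`. -/
def RawSemiring.IsIdem (A : RawSemiring.{u}) : Prop :=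
  (∀ a, A.add a a = a) ∧ (∀ a, A.mul a a = a)

/-- A distributive lattice: idempotent semiring with commutative `+` and `·`
satisfying the absorption law `a + ab = a`. -/
def RawSemiring.IsDistLat (T : RawSemiring.{u}) : Prop :=
  T.IsIdem ∧ (∀ a b, T.add a b = T.add b a) ∧ (∀ a b, T.mul a b = T.mul b a) ∧
    (∀ a b, T.add a (T.mul a b) = a)

/-- A semiring homomorphism between (the operations of) two algebras. -/
def IsHom {α : Type u} {β : Type u} (addA mulA : α → α → α)
    (addB mulB : β → β → β) (f : α → β) : Prop :=
  (∀ a b, f (addA a b) = addB (f a) (f b)) ∧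
    (∀ a b, f (mulA a b) = mulB (f a) (f b))

/-- A band semiring: an idempotent semiring, without identities and with possibly noncommutative
addition, in which `x + y * x * y + x = x`. -/
class BandSemiring (S : Type u) extends AddSemigroup S, Semigroup S, Distrib S where
  add_idem : ∀ a : S, a + a = a
  mul_idem : ∀ a : S, a * a = a
  add_conj_add : ∀ x y : S, x + y * x * y + x = x

namespace BandSemiring

variable {S : Type u} [BandSemiring S]

lemma add_idem_left (a b : S) : a + (a + b) = a + b := by
  rw [← add_assoc, add_idem]

/-- The preorder of divisibility in the additive band: `a` is a summand of `e`. -/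
def Below (a e : S) : Prop := e + a + e = e

lemma below_of_eq {a e p q : S} (h : e = p + a + q) : Below a e := by
  have hg : e = e + a + (q + p + a + e) := by
    calc e = p + a + q + (p + a + q) := by rw [← h, add_idem]
      _ = p + ((a + q) + (a + q)) + ((p + a) + (p + a)) + q := by
        rw [add_idem (a + q), add_idem (p + a)]; simp only [add_assoc]
      _ = p + a + q + a + (q + p + a + (p + a + q)) := by simp only [add_assoc]
      _ = _ := by rw [← h]
  calc e + a + e = e + a + (e + a + (q + p + a + e)) := by rw [← hg]
    _ = e + a + (q + p + a + e) := by rw [← add_assoc (e + a), add_idem]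
    _ = e := hg.symm

lemma Below.refl (a : S) : Below a a := by
  simp only [Below, add_idem]

lemma Below.trans {a b c : S} (hab : Below a b) (hbc : Below b c) : Below a c := by
  refine below_of_eq (p := c + b) (q := b + c) ?_
  calc c = c + (b + a + b) + c := by rw [hab, hbc]
    _ = _ := by simp only [add_assoc]

lemma below_add_left (a b : S) : Below a (a + b) :=
  below_of_eq (p := a) (q := b) (by rw [add_idem])

lemma below_add_right (a b : S) : Below b (a + b) :=
  below_of_eq (p := a) (q := b) (by rw [add_assoc, add_idem])

lemma Below.add {a b e : S} (ha : Below a e) (hb : Below b e) : Below (a + b) e := by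
  refine below_of_eq (p := e + (b + e)) (q := e + a + e) ?_
  calc e = e + b + e + a + e := by rw [hb, ha]
    _ = e + ((b + e + a) + (b + e + a)) + e := by rw [add_idem]; simp only [add_assoc]
    _ = _ := by simp only [add_assoc]

lemma Below.mul_left {a b : S} (h : Below a b) (c : S) : Below (c * a) (c * b) := by
  rw [Below, ← mul_add, ← mul_add, h]

lemma Below.mul_right {a b : S} (h : Below a b) (c : S) : Below (a * c) (b * c) := by
  rw [Below, ← add_mul, ← add_mul, h]

lemma mul_below_left (a b : S) : Below (a * b) a := by
  have h : Below (b * a * b) a := add_conj_add a b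
  have := h.mul_left a
  rwa [mul_idem, mul_assoc b, ← mul_assoc, mul_idem] at this

lemma mul_below_right (a b : S) : Below (a * b) b := by
  have h : Below (a * b * a) b := add_conj_add b a
  have := h.mul_right b
  rwa [mul_idem, mul_assoc (a * b), mul_idem] at this

lemma mul_below_mul_comm (a b : S) : Below (a * b) (b * a) := by
  have h : Below (a * b * (b * a) * (a * b)) (b * a) := add_conj_add _ _
  rwa [show a * b * (b * a) * (a * b) = a * (b * b) * (a * a) * b by simp only [mul_assoc],
    mul_idem, mul_idem, mul_assoc, mul_idem] at h

/-- A middle summand may be dropped if the outer ones are above it and each other. -/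
lemma add_add_eq_of_below {p q r : S} (hpr : Below p r) (hqr : Below q r) (hrp : Below r p) :
    p + q + r = p + r := by
  calc p + q + r = (p + r + p) + q + r := by rw [hrp]
    _ = p + (r + (p + q) + r) := by simp only [add_assoc]
    _ = p + r := by rw [hpr.add hqr]

/-- Additive Green's relation `R`. -/
def RRel (a b : S) : Prop := a + b = b ∧ b + a = a

lemma RRel.symm {a b : S} (h : RRel a b) : RRel b a := ⟨h.2, h.1⟩

lemma RRel.below {a b : S} (h : RRel a b) : Below a b := by
  rw [Below, h.2, h.1]

lemma RRel.add_eq_add_of_below {c d x : S} (h : RRel c d) (hcx : Below c x) (hdx : Below d x) :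
    c + x = d + x := by
  have hcd := h.below
  have hdc := h.symm.below
  have b₁ : Below c (c * d) := by simpa only [mul_idem] using hcd.mul_left c
  have b₂ : Below d (c * d) := by simpa only [mul_idem] using hdc.mul_right d
  have b₃ : Below c (c * x) := by simpa only [mul_idem] using hcx.mul_left c
  have b₄ : Below d (x * d) := by simpa only [mul_idem] using hdx.mul_right d
  have t₁ : Below (c * d) c := mul_below_left c d
  have t₂ : Below (c * d) d := mul_below_right c d
  have t₃ : Below (c * x) c := mul_below_left c x
  have t₄ : Below (x * d) d := mul_below_right x d
  have t₅ : Below (x * c) c := mul_below_right x c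
  have t₆ : Below (d * x) d := mul_below_left d x
  have u : c + x = c + c * x + x := by
    calc c + x = (c + x) * (c + x) := (mul_idem _).symm
      _ = c + x * c + c * x + x := by
        rw [mul_add, add_mul, add_mul, mul_idem, mul_idem]; simp only [add_assoc]
      _ = c + c * x + x := by rw [add_add_eq_of_below b₃ (t₅.trans b₃) t₃]
  have v : d + x = d + x * d + x := by
    calc d + x = (d + x) * (d + x) := (mul_idem _).symm
      _ = d + d * x + x * d + x := by
        rw [add_mul, mul_add, mul_add, mul_idem, mul_idem]; simp only [add_assoc]
      _ = d + x * d + x := by rw [add_add_eq_of_below b₄ (t₆.trans b₄) t₄]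
  have hc : c + c * d = c * d := by
    simpa only [mul_add, mul_idem] using congrArg (c * ·) h.1
  have hd : d + c * d = c * d := by
    simpa only [add_mul, mul_idem] using congrArg (· * d) h.2
  have uv₁ : (c + x) * (d + x) = c + x := by
    calc (c + x) * (d + x) = c * d + x * d + c * x + x := by
          rw [mul_add, add_mul, add_mul, mul_idem]; simp only [add_assoc]
      _ = c * d + c * x + x := by
        rw [add_add_eq_of_below (t₁.trans b₃) (t₄.trans (hdc.trans b₃)) (t₃.trans b₁)]
      _ = c + c * d + c * x + x := by rw [hc]
      _ = c + x := by rw [add_add_eq_of_below b₃ (t₁.trans b₃) t₃, u.symm]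
  have uv₂ : (c + x) * (d + x) = d + x := by
    calc (c + x) * (d + x) = c * d + c * x + x * d + x := by
          rw [add_mul, mul_add, mul_add, mul_idem]; simp only [add_assoc]
      _ = c * d + x * d + x := by
        rw [add_add_eq_of_below (t₂.trans b₄) (t₃.trans (hcd.trans b₄)) (t₄.trans b₂)]
      _ = d + c * d + x * d + x := by rw [hd]
      _ = d + x := by rw [add_add_eq_of_below b₄ (t₂.trans b₄) t₄, v.symm]
  exact uv₁.symm.trans uv₂

lemma RRel.add_right {c d : S} (h : RRel c d) (x : S) : RRel (c + x) (d + x) := by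
  have key : ∀ {c d : S}, RRel c d → c + x + (d + x) = d + x := by
    intro c d h
    have hd : Below d (x + (d + x)) := (below_add_left d x).trans (below_add_right _ _)
    have := h.add_eq_add_of_below (h.below.trans hd) hd
    rw [add_assoc, this, ← add_assoc, add_idem]
  exact ⟨key h, key h.symm⟩

lemma RRel.add_left {a b : S} (h : RRel a b) (c : S) : RRel (c + a) (c + b) := by
  have key : ∀ {a b : S}, RRel a b → c + a + (c + b) = c + b := by
    intro a b h
    calc c + a + (c + b) = (c + a) + (c + a) + b := by
          rw [← h.1]; simp only [add_assoc, add_idem_left]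
      _ = c + b := by rw [add_idem, add_assoc, h.1]
  exact ⟨key h, key h.symm⟩

lemma RRel.mul_left {a b : S} (h : RRel a b) (c : S) : RRel (c * a) (c * b) := by
  simp only [RRel, ← mul_add, h.1, h.2, and_self]

lemma RRel.mul_right {a b : S} (h : RRel a b) (c : S) : RRel (a * c) (b * c) := by
  simp only [RRel, ← add_mul, h.1, h.2, and_self]

lemma RRel.trans {a b c : S} (hab : RRel a b) (hbc : RRel b c) : RRel a c := by
  constructor
  · rw [← hbc.1, ← add_assoc, hab.1]
  · rw [← hab.2, ← add_assoc, hbc.2]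

/-- The congruence given by additive Green's relation `R`. -/
def rCon (S : Type u) [BandSemiring S] : RingCon S where
  r := RRel
  iseqv := ⟨fun a => ⟨add_idem a, add_idem a⟩, RRel.symm, RRel.trans⟩
  add' h h' := (h.add_right _).trans (h'.add_left _)
  mul' h h' := (h.mul_right _).trans (h'.mul_left _)

instance : BandSemiring Sᵃᵒᵖ where
  add_assoc a b c := AddOpposite.unop_injective (add_assoc c.unop b.unop a.unop).symm
  mul_assoc a b c := AddOpposite.unop_injective (mul_assoc a.unop b.unop c.unop)
  left_distrib a b c := AddOpposite.unop_injective (mul_add a.unop c.unop b.unop)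
  right_distrib a b c := AddOpposite.unop_injective (add_mul b.unop a.unop c.unop)
  add_idem a := AddOpposite.unop_injective (add_idem a.unop)
  mul_idem a := AddOpposite.unop_injective (mul_idem a.unop)
  add_conj_add x y := AddOpposite.unop_injective
    ((add_assoc _ _ _).symm.trans (add_conj_add x.unop y.unop))

/-- The congruence given by additive Green's relation `L`. -/
def lCon (S : Type u) [BandSemiring S] : RingCon S where
  r a b := RRel (AddOpposite.op a) (AddOpposite.op b)
  iseqv := (rCon Sᵃᵒᵖ).iseqv.comap AddOpposite.op
  add' h h' := (rCon Sᵃᵒᵖ).add' h' h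
  mul' h h' := (rCon Sᵃᵒᵖ).mul' h h'

lemma lCon_iff {a b : S} : lCon S a b ↔ b + a = b ∧ a + b = a :=
  ⟨fun h => ⟨congrArg AddOpposite.unop h.1, congrArg AddOpposite.unop h.2⟩,
    fun h => ⟨congrArg AddOpposite.op h.1, congrArg AddOpposite.op h.2⟩⟩

/-- The congruence given by additive Green's relation `D`. -/
def dCon (S : Type u) [BandSemiring S] : RingCon S where
  r a b := Below a b ∧ Below b a
  iseqv := ⟨fun a => ⟨.refl a, .refl a⟩, And.symm, fun h h' => ⟨h.1.trans h'.1, h'.2.trans h.2⟩⟩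
  add' h h' :=
    ⟨(h.1.trans (below_add_left _ _)).add (h'.1.trans (below_add_right _ _)),
      (h.2.trans (below_add_left _ _)).add (h'.2.trans (below_add_right _ _))⟩
  mul' h h' :=
    ⟨(h.1.mul_right _).trans (h'.1.mul_left _), (h.2.mul_right _).trans (h'.2.mul_left _)⟩

lemma dCon_iff {a b : S} : dCon S a b ↔ Below a b ∧ Below b a := Iff.rfl

lemma rCon_le_dCon {a b : S} (h : rCon S a b) : dCon S a b :=
  ⟨RRel.below h, RRel.below h.symm⟩

lemma lCon_le_dCon {a b : S} (h : lCon S a b) : dCon S a b := by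
  rw [lCon_iff] at h
  exact ⟨by rw [Below, h.1, add_idem], by rw [Below, h.2, add_idem]⟩

/-- The quotient of a band semiring by a congruence, as a bundled semiring. -/
def quot (c : RingCon S) : RawSemiring.{u} where
  carrier := c.Quotient
  add := (· + ·)
  mul := (· * ·)
  add_assoc := by
    rintro ⟨a⟩ ⟨b⟩ ⟨d⟩
    exact congrArg ((↑) : S → c.Quotient) (add_assoc a b d)
  mul_assoc := by
    rintro ⟨a⟩ ⟨b⟩ ⟨d⟩
    exact congrArg ((↑) : S → c.Quotient) (mul_assoc a b d)
  left_distrib := by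
    rintro ⟨a⟩ ⟨b⟩ ⟨d⟩
    exact congrArg ((↑) : S → c.Quotient) (mul_add a b d)
  right_distrib := by
    rintro ⟨a⟩ ⟨b⟩ ⟨d⟩
    exact congrArg ((↑) : S → c.Quotient) (add_mul a b d)

lemma quot_isIdem (c : RingCon S) : (quot c).IsIdem := by
  constructor
  · rintro ⟨a⟩
    exact congrArg ((↑) : S → c.Quotient) (add_idem a)
  · rintro ⟨a⟩
    exact congrArg ((↑) : S → c.Quotient) (mul_idem a)

lemma quot_dCon_isDistLat : (quot (dCon S)).IsDistLat := by
  refine ⟨quot_isIdem _, ?_, ?_, ?_⟩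
  · rintro ⟨a⟩ ⟨b⟩
    exact (dCon S).eq.2 ⟨(below_add_right b a).add (below_add_left b a),
      (below_add_right a b).add (below_add_left a b)⟩
  · rintro ⟨a⟩ ⟨b⟩
    exact (dCon S).eq.2 ⟨mul_below_mul_comm a b, mul_below_mul_comm b a⟩
  · rintro ⟨a⟩ ⟨b⟩
    exact (dCon S).eq.2 ⟨(Below.refl a).add (mul_below_left a b), below_add_left _ _⟩

lemma quot_rCon_left_band (x y : (quot (rCon S)).carrier) :
    (quot (rCon S)).add x ((quot (rCon S)).mul ((quot (rCon S)).mul y x) y) = x := by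
  obtain ⟨a⟩ := x
  obtain ⟨b⟩ := y
  exact (rCon S).eq.2 ⟨add_conj_add a b, add_idem_left _ _⟩

lemma quot_lCon_right_band (x y : (quot (lCon S)).carrier) :
    (quot (lCon S)).add ((quot (lCon S)).mul ((quot (lCon S)).mul y x) y) x = x := by
  obtain ⟨a⟩ := x
  obtain ⟨b⟩ := y
  refine (lCon S).eq.2 (lCon_iff.2 ⟨?_, ?_⟩)
  · rw [← add_assoc, add_conj_add]
  · rw [add_assoc, add_idem]

/-- The projection between quotients by comparable congruences. -/
def quotMap {c d : RingCon S} (h : ∀ {a b}, c a b → d a b) :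
    (quot c).carrier → (quot d).carrier :=
  Quotient.map' id fun _ _ => h

lemma quotMap_isHom {c d : RingCon S} (h : ∀ {a b}, c a b → d a b) :
    IsHom (quot c).add (quot c).mul (quot d).add (quot d).mul (quotMap h) := by
  constructor <;>
  · rintro ⟨a⟩ ⟨b⟩
    rfl

lemma quotMap_surjective {c d : RingCon S} (h : ∀ {a b}, c a b → d a b) :
    Function.Surjective (quotMap h) := by
  rintro ⟨a⟩
  exact ⟨(a : c.Quotient), rfl⟩

end BandSemiring

/-- An idempotent semiring is a band semiring
(`x + yxy + x = x`) iff it is a spined product of a left band semiring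
(`x = x + yxy`) and a right band semiring (`x = yxy + x`) with respect to a
distributive lattice. -/
theorem band_orthorings_stmt9
    {S : Type u} [Add S] [Mul S]
    (add_assoc : ∀ a b c : S, a + b + c = a + (b + c))
    (mul_assoc : ∀ a b c : S, a * b * c = a * (b * c))
    (left_distrib : ∀ a b c : S, a * (b + c) = a * b + a * c)
    (right_distrib : ∀ a b c : S, (a + b) * c = a * c + b * c)
    (add_idem : ∀ a : S, a + a = a)
    (mul_idem : ∀ a : S, a * a = a) :
    (∀ x y : S, x + y * x * y + x = x) ↔
      ∃ (S₁ S₂ T : RawSemiring.{u})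
        (φ₁ : S₁.carrier → T.carrier) (φ₂ : S₂.carrier → T.carrier)
        (θ : S → S₁.carrier × S₂.carrier),
        -- S₁ is a left band semiring
        (S₁.IsIdem ∧ ∀ x y, S₁.add x (S₁.mul (S₁.mul y x) y) = x) ∧
        -- S₂ is a right band semiring
        (S₂.IsIdem ∧ ∀ x y, S₂.add (S₂.mul (S₂.mul y x) y) x = x) ∧
        -- T is a distributive lattice
        T.IsDistLat ∧
        -- φ₁, φ₂ are surjective homomorphisms
        IsHom S₁.add S₁.mul T.add T.mul φ₁ ∧ Function.Surjective φ₁ ∧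
        IsHom S₂.add S₂.mul T.add T.mul φ₂ ∧ Function.Surjective φ₂ ∧
        -- θ is a bijection from S onto the spined product,
        -- preserving + and ·
        (∀ a : S, φ₁ (θ a).1 = φ₂ (θ a).2) ∧
        Function.Injective θ ∧
        (∀ p : S₁.carrier × S₂.carrier, φ₁ p.1 = φ₂ p.2 → ∃ a : S, θ a = p) ∧
        (∀ a b : S,
          θ (a + b) = (S₁.add (θ a).1 (θ b).1, S₂.add (θ a).2 (θ b).2)) ∧
        (∀ a b : S,
          θ (a * b) = (S₁.mul (θ a).1 (θ b).1, S₂.mul (θ a).2 (θ b).2)) := by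
  constructor
  · intro band
    let _ : BandSemiring S :=
      { add_assoc, mul_assoc, left_distrib, right_distrib, add_idem, mul_idem,
        add_conj_add := band }
    refine ⟨BandSemiring.quot (BandSemiring.rCon S), BandSemiring.quot (BandSemiring.lCon S),
      BandSemiring.quot (BandSemiring.dCon S), BandSemiring.quotMap BandSemiring.rCon_le_dCon,
      BandSemiring.quotMap BandSemiring.lCon_le_dCon,
      fun a => ((a : (BandSemiring.rCon S).Quotient), (a : (BandSemiring.lCon S).Quotient)),
      ⟨BandSemiring.quot_isIdem _, BandSemiring.quot_rCon_left_band⟩,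
      ⟨BandSemiring.quot_isIdem _, BandSemiring.quot_lCon_right_band⟩,
      BandSemiring.quot_dCon_isDistLat,
      BandSemiring.quotMap_isHom _, BandSemiring.quotMap_surjective _,
      BandSemiring.quotMap_isHom _, BandSemiring.quotMap_surjective _,
      fun _ => rfl, ?_, ?_, fun _ _ => rfl, fun _ _ => rfl⟩
    · intro a b h
      have hr := (BandSemiring.rCon S).eq.1 (Prod.mk.inj h).1
      have hl := (BandSemiring.lCon S).eq.1 (Prod.mk.inj h).2
      exact (BandSemiring.lCon_iff.1 hl).2.symm.trans hr.1
    · rintro ⟨⟨a⟩, ⟨b⟩⟩ h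
      obtain ⟨hab, hba⟩ := BandSemiring.dCon_iff.1 ((BandSemiring.dCon S).eq.1 h)
      refine ⟨a + b, Prod.ext ((BandSemiring.rCon S).eq.2 ⟨hba, ?_⟩)
        ((BandSemiring.lCon S).eq.2 (BandSemiring.lCon_iff.2 ⟨?_, ?_⟩))⟩
      · exact BandSemiring.add_idem_left a b
      · rw [← add_assoc]
        exact hab
      · rw [add_assoc, add_idem]
  · rintro ⟨S₁, S₂, T, φ₁, φ₂, θ, ⟨idem₁, band₁⟩, ⟨idem₂, band₂⟩, -, -, -, -, -, -, inj, -,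
      map_add, map_mul⟩ x y
    apply inj
    refine Prod.ext ?_ ?_
    · simp only [map_add, map_mul, band₁, idem₁.1]
    · simp only [map_add, map_mul, S₂.add_assoc, band₂, idem₂.1]
end

section
/- Let S be a completely regular semiring. Then S is an orthoring (i.e., E⁺(S) is closed under + and ·) if and only if S is a b-lattice of rectangular rings; that is, if and only if there exists a congruence ρ on S such that (a+a) ρ a, (a·a) ρ a and (a+b) ρ (b+a) for all a,b ∈ S (so S/ρ is a b-lattice), and each ρ-class is closed under +, · and ′ and its additive idempotents e, f satisfy e + f + e = e (so each ρ-class is a rectangular ring). -/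
/-- In an additive semigroup with idempotents closed under addition, `e + f + e = e` holds as soon
as the idempotent `e` factors through the idempotent `f` by idempotents. -/
theorem add_add_self_of_idem_factor {S : Type*} [AddSemigroup S]
    (hE : ∀ e f : S, e + e = e → f + f = f → (e + f) + (e + f) = e + f)
    {u f v : S} (hu : u + u = u) (hf : f + f = f) (hv : v + v = v) :
    (u + f + v) + f + (u + f + v) = u + f + v := by
  have huf := hE u f hu hf
  have hfv := hE f v hf hv
  have hw := hE (u + f) v huf hv
  have hk := hE (f + v) u hfv hu
  have hwf := hE (u + f + v) f hw hf
  set w := u + f + v with hwd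
  have h1 : w + (f + v + u) + w = w := by grind
  have h2 : (w + f) + (v + u + w) = w := by grind
  calc w + f + w = w + f + ((w + f) + (v + u + w)) := by rw [h2]
    _ = (w + f + (w + f)) + (v + u + w) := by simp only [add_assoc]
    _ = w := by rw [hwf, h2]

/-- In an additive band, the relation `e + f + e = e` is transitive. -/
theorem idem_below_trans {S : Type*} [AddSemigroup S]
    (hE : ∀ e f : S, e + e = e → f + f = f → (e + f) + (e + f) = e + f)
    {e f g : S} (he : e + e = e) (hf : f + f = f) (hg : g + g = g)
    (hef : e + f + e = e) (hfg : f + g + f = f) : e + g + e = e := by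
  have h := add_add_self_of_idem_factor hE (hE e f he hf) hg (hE f e hf he)
  have h1 : (e + f) + g + (f + e) = e := by grind
  rwa [h1] at h

/-- In an additive band, `f + g` lies above every element lying below both `f` and `g`. -/
theorem idem_below_add {S : Type*} [AddSemigroup S]
    (hE : ∀ e f : S, e + e = e → f + f = f → (e + f) + (e + f) = e + f)
    {w f g : S} (hw : w + w = w) (hf : f + f = f) (hg : g + g = g)
    (hwf : w + f + w = w) (hwg : w + g + w = w) : w + (f + g) + w = w := by
  have hp := hE w f hw hf
  have hq := hE g w hg hw
  have h : (w + f) + (g + w) + (w + f) = w + f :=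
    idem_below_trans hE hp hw hq (by grind) (by grind)
  calc w + (f + g) + w = ((w + f) + (g + w)) + (w + f + w) := by grind
    _ = ((w + f) + (g + w) + (w + f)) + w := by simp only [add_assoc]
    _ = w := by rw [h, hwf]

/-- In an additive orthogroup, an idempotent factoring through the idempotent `w` lies below `w`. -/
theorem idem_below_of_factor {S : Type*} [AddSemigroup S] (inv : S → S)
    (cr1 : ∀ x : S, x + inv x + x = x) (cr2 : ∀ x : S, x + inv x = inv x + x)
    (hE : ∀ e f : S, e + e = e → f + f = f → (e + f) + (e + f) = e + f)
    {e w x y : S} (he : e + e = e) (hw : w + w = w) (h : e = x + w + y) :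
    e + w + e = e := by
  set p := e + x + w with hp
  set q := w + y + e with hq
  set r := p + inv p with hr
  have hpq : p + q = e := by grind
  have hep : e + p = p := by grind
  have hg : (q + p) + (q + p) = q + p := by grind
  have hrr : r + r = r := by rw [hr, ← add_assoc, cr1]
  have hrp : r + p = p := cr1 p
  have hpr : p + r = p := by rw [hr, cr2, ← add_assoc, cr1]
  have hre : r + e = e := by rw [← hpq, ← add_assoc, hrp]
  have hrg : r + (q + p) = r := by
    rw [hr, cr2 p, add_assoc, ← add_assoc p q p, hpq, hep]
  have hgr : (q + p) + r = q + p := by rw [add_assoc, hpr]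
  have h1 : e + (q + p) + e = e :=
    idem_below_trans hE he hrr hg (by rw [add_assoc, hre, he]) (by rw [hrg, hrr])
  have hpw : p + w = p := by rw [hp, add_assoc, hw]
  exact idem_below_trans hE he hg hw h1 (by rw [add_assoc q p w, hpw, hg])

/-- A semilattice of rectangular groups has additive idempotents closed under addition. -/
theorem idem_add_closed_of_semilattice {S : Type*} [AddSemigroup S] (inv : S → S)
    (cr1 : ∀ x : S, x + inv x + x = x) (cr2 : ∀ x : S, x + inv x = inv x + x)
    (ρ : S → S → Prop) (hρ : Equivalence ρ)
    (hadd : ∀ a b c d : S, ρ a b → ρ c d → ρ (a + c) (b + d))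
    (hidem : ∀ a : S, ρ (a + a) a) (hcomm : ∀ a b : S, ρ (a + b) (b + a))
    (hinv : ∀ a : S, ρ (inv a) a)
    (hrect : ∀ e f : S, e + e = e → f + f = f → ρ e f → e + f + e = e)
    {e f : S} (he : e + e = e) (hf : f + f = f) : (e + f) + (e + f) = e + f := by
  set x := e + f with hx
  set r := x + inv x with hr
  have hrr : r + r = r := by rw [hr, ← add_assoc, cr1]
  have hrx : r + x = x := cr1 x
  have hxr : x + r = x := by rw [hr, cr2, ← add_assoc, cr1]
  have her : e + r = r := by rw [hr, hx, ← add_assoc, ← add_assoc, he]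
  have hrf : r + f = r := by rw [hr, cr2, add_assoc, hx, add_assoc e f f, hf]
  have hρr : ρ r x := hρ.trans (hadd x x _ _ (hρ.refl x) (hinv x)) (hidem x)
  have hfx : ρ (f + r) x := by
    refine hρ.trans (hadd f f _ _ (hρ.refl f) hρr) (hρ.trans (hcomm _ _) ?_)
    rw [hx, add_assoc, hf]
    exact hρ.refl _
  have hxe : ρ (r + e) x := by
    refine hρ.trans (hadd _ _ e e hρr (hρ.refl e)) (hρ.trans (hcomm _ _) ?_)
    rw [hx, ← add_assoc, he]
    exact hρ.refl _
  have hre : (r + e) + (r + e) = r + e := by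
    rw [add_assoc, ← add_assoc e r e, her, ← add_assoc, hrr]
  have hfr : (f + r) + (f + r) = f + r := by
    rw [add_assoc, ← add_assoc r f r, hrf, hrr]
  have h := hrect (r + e) (f + r) hre hfr (hρ.trans hxe (hρ.symm hfx))
  have hprod : (r + e) + (f + r) = x := by
    calc (r + e) + (f + r) = r + (e + f) + r := by simp only [add_assoc]
      _ = x := by rw [← hx, hrx, hxr]
  calc x + x = ((r + e) + (f + r) + (r + e)) + (f + r) := by rw [add_assoc _ (r + e), hprod]
    _ = x := by rw [h, hprod]

/-- In an additive orthogroup, the idempotent of a sum is equivalent to the sum of the idempotents. -/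
theorem idem_add_equiv_add_idem {S : Type*} [AddSemigroup S] (inv : S → S)
    (cr1 : ∀ x : S, x + inv x + x = x) (cr2 : ∀ x : S, x + inv x = inv x + x)
    (hE : ∀ e f : S, e + e = e → f + f = f → (e + f) + (e + f) = e + f) (a b : S) :
    let w := a + b + inv (a + b)
    let t := (a + inv a) + (b + inv b)
    w + t + w = w ∧ t + w + t = t := by
  intro w t
  have hidem : ∀ x : S, (x + inv x) + (x + inv x) = x + inv x := fun x => by
    rw [← add_assoc, cr1]
  have hw : w + w = w := hidem _
  have haw : (a + inv a) + w = w := by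
    change (a + inv a) + (a + b + inv (a + b)) = a + b + inv (a + b)
    rw [← add_assoc, ← add_assoc, cr1]
  have hwb : w + (b + inv b) = w := by
    change a + b + inv (a + b) + (b + inv b) = a + b + inv (a + b)
    rw [cr2 (a + b), cr2 b, add_assoc, add_assoc a, ← add_assoc b, cr1]
  refine ⟨idem_below_add hE hw (hidem a) (hidem b) ?_ ?_,
    idem_below_of_factor inv cr1 cr2 hE (x := inv a + (a + b)) (y := inv b)
      (hE _ _ (hidem a) (hidem b)) hw ?_⟩
  · rw [add_assoc, haw, hw]
  · rw [hwb, hw]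
  · have : a + b + w = a + b := by
      change a + b + (a + b + inv (a + b)) = a + b
      rw [cr2 (a + b), ← add_assoc, cr1]
    rw [add_assoc (inv a), this]
    change a + inv a + (b + inv b) = _
    rw [cr2 a]
    simp only [add_assoc]


/-- A completely regular semiring is an orthoring (its additive
idempotents are closed under `+` and `·`) iff it is a b-lattice of rectangular
rings: there is a congruence `ρ` whose quotient is a b-lattice, each of whose
classes is closed under `+`, `·`, `′` and whose additive idempotents `e`, `f`
satisfy `e + f + e = e`. -/
theorem band_orthorings_stmt13
    {S : Type*} [Add S] [Mul S] (inv : S → S)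
    (add_assoc : ∀ a b c : S, a + b + c = a + (b + c))
    (mul_assoc : ∀ a b c : S, a * b * c = a * (b * c))
    (left_distrib : ∀ a b c : S, a * (b + c) = a * b + a * c)
    (right_distrib : ∀ a b c : S, (a + b) * c = a * c + b * c)
    (cr1 : ∀ x : S, x + inv x + x = x)
    (cr2 : ∀ x : S, x + inv x = inv x + x)
    (cr3 : ∀ x : S, inv (inv x) = x)
    (cr4 : ∀ x y : S,
      x + (y + inv y) + (x + inv x) + y = (x + inv x) + y + x + (y + inv y))
    (cr5 : ∀ x : S, x * (x + inv x) = x + inv x) :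
    -- S is an orthoring: E⁺(S) is closed under + and ·
    (∀ e f : S, e + e = e → f + f = f →
        ((e + f) + (e + f) = e + f ∧ (e * f) + (e * f) = e * f)) ↔
      -- S is a b-lattice of rectangular rings
      ∃ ρ : S → S → Prop,
        Equivalence ρ ∧
        (∀ a b c d : S, ρ a b → ρ c d → ρ (a + c) (b + d) ∧ ρ (a * c) (b * d)) ∧
        -- the quotient is a b-lattice
        (∀ a : S, ρ (a + a) a) ∧ (∀ a : S, ρ (a * a) a) ∧
        (∀ a b : S, ρ (a + b) (b + a)) ∧
        -- each ρ-class is closed under +, · and ′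
        (∀ a b : S, ρ a b → ρ (a + b) a ∧ ρ (a * b) a) ∧
        (∀ a : S, ρ (inv a) a) ∧
        -- the additive idempotents of each ρ-class form a rectangular band
        (∀ e f : S, e + e = e → f + f = f → ρ e f → e + f + e = e) := by
  let _ : AddSemigroup S := { add_assoc := add_assoc }
  constructor
  · intro hES
    have hE : ∀ e f : S, e + e = e → f + f = f → (e + f) + (e + f) = e + f :=
      fun e f he hf => (hES e f he hf).1
    have hO : ∀ x : S, (x + inv x) + (x + inv x) = x + inv x := fun x => by
      rw [← add_assoc, cr1]
    have huniq : ∀ x y : S, x + y + x = x → x + y = y + x → x + inv x = x + y := by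
      intro x y h1 h2
      have h3 : x + inv x = (x + y) + (x + inv x) := by rw [← add_assoc, h1]
      have h4 : x + y = (x + y) + (x + inv x) := by
        rw [cr2, h2, add_assoc, ← add_assoc x (inv x) x, cr1]
      rw [h3, ← h4]
    have hml : ∀ a b : S, a * b + inv (a * b) = a * (b + inv b) := fun a b => by
      rw [left_distrib]
      exact huniq _ _ (by rw [← left_distrib, ← left_distrib, cr1])
        (by rw [← left_distrib, ← left_distrib, cr2])
    have hmr : ∀ a b : S, a * b + inv (a * b) = (a + inv a) * b := fun a b => by
      rw [right_distrib]
      exact huniq _ _ (by rw [← right_distrib, ← right_distrib, cr1])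
        (by rw [← right_distrib, ← right_distrib, cr2])
    have hm : ∀ a b : S, a * b + inv (a * b) = (a + inv a) * (b + inv b) := fun a b => by
      have h := huniq (a * (b + inv b)) (a * (b + inv b))
        (by rw [← left_distrib, ← left_distrib, hO, hO]) rfl
      rw [hmr, ← left_distrib, hO] at h
      rw [hml, h]
    have hid : ∀ e : S, e + e = e → e + inv e = e := fun e he => by
      rw [huniq e e (by rw [he, he]) rfl, he]
    have htr : ∀ {e f g : S}, e + e = e → f + f = f → g + g = g →
        e + f + e = e → f + g + f = f → e + g + e = e := idem_below_trans hE
    have hmono : ∀ {e f g h : S}, e + e = e → f + f = f → g + g = g → h + h = h →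
        e + f + e = e → g + h + g = g → (e + g) + (f + h) + (e + g) = e + g := by
      intro e f g h he hf hg hh hef hgh
      have heg := hE e g he hg
      refine idem_below_add hE heg hf hh (htr heg he hf ?_ hef) (htr heg hg hh ?_ hgh)
      · rw [add_assoc, ← add_assoc e e g, he, heg]
      · rw [add_assoc e g g, hg, heg]
    have hmul : ∀ {e f g h : S}, e + f + e = e → g + h + g = g → h + h = h → e + e = e →
        f + f = f → g + g = g →
        e * g + f * h + e * g = e * g := by
      intro e f g h hef hgh hh he hf hg
      have h1 : e * g + f * g + e * g = e * g := by rw [← right_distrib, ← right_distrib, hef]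
      have h2 : f * g + f * h + f * g = f * g := by rw [← left_distrib, ← left_distrib, hgh]
      exact htr (by rw [← left_distrib, hg]) (by rw [← left_distrib, hg])
        (by rw [← left_distrib, hh]) h1 h2
    have hsum := idem_add_equiv_add_idem inv cr1 cr2 hE
    have hOO : ∀ a b : S, ((a + inv a) + (b + inv b)) + ((a + inv a) + (b + inv b)) =
        (a + inv a) + (b + inv b) := fun a b => hE _ _ (hO a) (hO b)
    let B : S → S → Prop := fun a b => (a + inv a) + (b + inv b) + (a + inv a) = a + inv a
    have hBrefl : ∀ {a b : S}, a + inv a = b + inv b → B a b := fun {a b} h => by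
      change (a + inv a) + (b + inv b) + (a + inv a) = a + inv a
      rw [← h, hO, hO]
    have hBtr : ∀ {a b c : S}, B a b → B b c → B a c := fun {a b c} h1 h2 =>
      htr (hO a) (hO b) (hO c) h1 h2
    have hBadd : ∀ {a b c d : S}, B a b → B c d → B (a + c) (b + d) := fun {a b c d} h1 h2 =>
      htr (hO _) (hOO a c) (hO _) (hsum a c).1
        (htr (hOO a c) (hOO b d) (hO _) (hmono (hO a) (hO b) (hO c) (hO d) h1 h2) (hsum b d).2)
    have hBmul : ∀ {a b c d : S}, B a b → B c d → B (a * c) (b * d) := fun {a b c d} h1 h2 => by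
      change (a * c + inv (a * c)) + (b * d + inv (b * d)) + (a * c + inv (a * c)) =
        a * c + inv (a * c)
      rw [hm, hm]
      exact hmul h1 h2 (hO d) (hO a) (hO b) (hO c)
    have hBsq : ∀ a : S, a * a + inv (a * a) = a + inv a := fun a => by rw [hml, cr5]
    have hBinv : ∀ a : S, inv a + inv (inv a) = a + inv a := fun a => by rw [cr3, cr2]
    have hdbl : ∀ a : S, B (a + a) a ∧ B a (a + a) := fun a => by
      have h := hsum a a
      simp only [hO] at h
      exact h
    have hcomm : ∀ a b : S, B (a + b) (b + a) := fun a b =>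
      htr (hO _) (hOO a b) (hO _) (hsum a b).1
        (htr (hOO a b) (hOO b a) (hO _)
          (by
            have h1 := hOO a b
            refine idem_below_add hE h1 (hO b) (hO a) ?_ ?_
            · rw [add_assoc (a + inv a) (b + inv b) (b + inv b), hO, h1]
            · rw [add_assoc, ← add_assoc (a + inv a) (a + inv a), hO, h1])
          (hsum b a).2)
    refine ⟨fun a b => B a b ∧ B b a,
      ⟨fun a => ⟨hBrefl rfl, hBrefl rfl⟩, fun h => ⟨h.2, h.1⟩,
        fun h1 h2 => ⟨hBtr h1.1 h2.1, hBtr h2.2 h1.2⟩⟩,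
      fun a b c d h1 h2 => ⟨⟨hBadd h1.1 h2.1, hBadd h1.2 h2.2⟩,
        ⟨hBmul h1.1 h2.1, hBmul h1.2 h2.2⟩⟩,
      hdbl, fun a => ⟨hBrefl (hBsq a), hBrefl (hBsq a).symm⟩,
      fun a b => ⟨hcomm a b, hcomm b a⟩, ?_,
      fun a => ⟨hBrefl (hBinv a), hBrefl (hBinv a).symm⟩, ?_⟩
    · rintro a b ⟨h1, h2⟩
      have hr : B a a := hBrefl rfl
      exact ⟨⟨hBtr (hBadd hr h2) (hdbl a).1, hBtr (hdbl a).2 (hBadd hr h1)⟩,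
        ⟨hBtr (hBmul hr h2) (hBrefl (hBsq a)), hBtr (hBrefl (hBsq a).symm) (hBmul hr h1)⟩⟩
    · rintro e f he hf ⟨h, -⟩
      change (e + inv e) + (f + inv f) + (e + inv e) = e + inv e at h
      rwa [hid e he, hid f hf] at h
  · rintro ⟨ρ, hρ, hcong, hidem, -, hcomm, -, hinv, hrect⟩ e f he hf
    exact ⟨idem_add_closed_of_semilattice inv cr1 cr2 ρ hρ
      (fun a b c d h1 h2 => (hcong a b c d h1 h2).1) hidem hcomm hinv hrect he hf,
      by rw [← right_distrib, he]⟩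
end

section
/- Let S be a completely regular semiring. Then S is a band orthoring (i.e., E⁺(S) is closed under + and · and satisfies e+ef+e = e and e+fe+e = e for all e,f ∈ E⁺(S)) if and only if S is a distributive lattice of rectangular rings; that is, if and only if there exists a congruence ρ on S such that (a+a) ρ a, (a·a) ρ a, (a+b) ρ (b+a), (ab) ρ (ba) and (a+ab) ρ a for all a,b ∈ S (so S/ρ is a distributive lattice), and each ρ-class is closed under +, · and ′ and its additive idempotents e, f satisfy e + f + e = e (so each ρ-class is a rectangular ring). -/
/-- The natural quasi-order of an additive band: `e` lies in the ideal generated by `f`. -/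
def BandLE {S : Type*} [Add S] (e f : S) : Prop := e + f + e = e

namespace BandLE

variable {S : Type*} [AddSemigroup S]

theorem of_add_left {e f : S} (he : e + e = e) (h : f + e = e) : BandLE e f := by
  rw [BandLE, add_assoc, h, he]

theorem of_add_right {e f : S} (he : e + e = e) (h : e + f = e) : BandLE e f := by
  rw [BandLE, h, he]

theorem refl {e : S} (he : e + e = e) : BandLE e e := of_add_left he he

theorem trans (hE : ∀ e f : S, e + e = e → f + f = f → (e + f) + (e + f) = e + f)
    {e f g : S} (he : e + e = e) (hf : f + f = f) (hg : g + g = g)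
    (h₁ : BandLE e f) (h₂ : BandLE f g) : BandLE e g := by
  unfold BandLE at *
  have hk := hE (g + f) e (hE g f hg hf) he
  have heg := hE e g he hg
  have h : e + f + (g + f + e) = e := by grind
  have h' : e + (g + f + e) = e := by grind
  grind

theorem add (hE : ∀ e f : S, e + e = e → f + f = f → (e + f) + (e + f) = e + f)
    {e f g : S} (he : e + e = e) (hf : f + f = f) (hg : g + g = g)
    (h₁ : BandLE g e) (h₂ : BandLE g f) : BandLE g (e + f) := by
  unfold BandLE at *
  have hk := hE (f + g) e (hE f g hf hg) he
  have h : g + e + f + (g + e) = g + e := by grind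
  grind

theorem add_le_left {e f : S} (he : e + e = e) (hef : (e + f) + (e + f) = e + f) :
    BandLE (e + f) e :=
  of_add_left hef (by rw [← add_assoc, he])

theorem add_le_right {e f : S} (hf : f + f = f) (hef : (e + f) + (e + f) = e + f) :
    BandLE (e + f) f :=
  of_add_right hef (by rw [add_assoc, hf])

end BandLE

section CommutingInverse

variable {S : Type*} [AddSemigroup S]

theorem add_eq_add_of_commuting_inverses {x u v : S} (hu : x + u + x = x) (hv : x + v + x = x)
    (cu : x + u = u + x) (cv : x + v = v + x) : x + u = x + v := by
  have h : v + (x + u) + x = v + x := by rw [add_assoc v, hu]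
  have h' : v + x + (x + u) = x + u := by rw [← cv, ← add_assoc, hv]
  rw [← h', add_assoc, cu, ← add_assoc x, hu, cv]

variable {inv : S → S} (cr1 : ∀ x : S, x + inv x + x = x)
  (cr2 : ∀ x : S, x + inv x = inv x + x)

include cr1 in
theorem add_inv_add_self (x : S) : (x + inv x) + (x + inv x) = x + inv x := by
  rw [← add_assoc, cr1]

include cr1 cr2 in
theorem add_inv_of_idem {e : S} (he : e + e = e) : e + inv e = e := by
  rw [add_eq_add_of_commuting_inverses (cr1 e) (v := e) (by rw [he, he]) (cr2 e) rfl, he]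

include cr2 in
theorem add_inv_right_absorb {x f : S} (h : x + f = x) : x + inv x + f = x + inv x := by
  rw [cr2, add_assoc, h]

theorem add_inv_left_absorb {x f : S} (h : f + x = x) : f + (x + inv x) = x + inv x := by
  rw [← add_assoc, h]

include cr1 cr2 in
theorem add_inv_bandLE (hE : ∀ e f : S, e + e = e → f + f = f → (e + f) + (e + f) = e + f)
    (a b : S) :
    BandLE (a + b + inv (a + b)) (a + inv a + (b + inv b)) ∧
      BandLE (a + inv a + (b + inv b)) (a + b + inv (a + b)) := by
  have hi := add_inv_add_self cr1
  have hb : b + (b + inv b) = b := by rw [cr2, ← add_assoc, cr1]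
  constructor
  · refine BandLE.add hE (hi _) (hi _) (hi _) ?_ ?_
    · exact .of_add_left (hi _) (add_inv_left_absorb (by rw [← add_assoc, cr1]))
    · exact .of_add_right (hi _) (add_inv_right_absorb cr2 (by rw [add_assoc, hb]))
  · have hab := hE _ _ (hi a) (hi b)
    have hbab := hE _ _ (hi b) hab
    -- `y` is `a + b°`; one has `a° + b° ≤ b° + a° + b° ≤ y° ≤ (a + b)°`
    set y := a + (b + inv b) with hy
    have h₁ : BandLE (a + inv a + (b + inv b)) (b + inv b + (a + inv a + (b + inv b))) :=
      BandLE.add hE (hi _) hab hab (.add_le_right (hi _) hab) (.refl hab)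
    have h₂ : BandLE (b + inv b + (a + inv a + (b + inv b))) (y + inv y) := by
      refine .of_add_right hbab ?_
      have : b + inv b + (a + inv a + (b + inv b)) = b + inv b + inv a + y := by
        rw [cr2 a, hy]; simp only [add_assoc]
      have hyy : y + (y + inv y) = y := by rw [cr2, ← add_assoc, cr1]
      rw [this, add_assoc, hyy]
    have h₃ : BandLE (y + inv y) (a + b + inv (a + b)) := by
      refine .of_add_left (hi _) (add_inv_left_absorb ?_)
      rw [hy, ← add_assoc a, ← add_assoc (a + b + _), cr1]
    exact (h₁.trans hE hab hbab (hi _) h₂).trans hE hab (hi _) (hi _) h₃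

end CommutingInverse

/-- Sums of additive idempotents are idempotent when the idempotents are locally rectangular
with respect to a semilattice congruence of a completely regular semigroup. -/
theorem add_idem_of_semilattice {S : Type*} [AddSemigroup S] {inv : S → S}
    (cr1 : ∀ x : S, x + inv x + x = x) (cr2 : ∀ x : S, x + inv x = inv x + x)
    {ρ : S → S → Prop} (hρ : Equivalence ρ)
    (hadd : ∀ a b c d : S, ρ a b → ρ c d → ρ (a + c) (b + d))
    (hcomm : ∀ a b : S, ρ (a + b) (b + a)) (hidem : ∀ a : S, ρ (a + a) a)
    (hinv : ∀ a : S, ρ (inv a) a)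
    (hrect : ∀ e f : S, e + e = e → f + f = f → ρ e f → e + f + e = e)
    {e f : S} (he : e + e = e) (hf : f + f = f) : (e + f) + (e + f) = e + f := by
  set x := e + f with hx
  have hi := add_inv_add_self cr1 x
  have hex : e + (x + inv x) = x + inv x :=
    add_inv_left_absorb (by rw [hx, ← add_assoc, he])
  have hxf : x + inv x + f = x + inv x :=
    add_inv_right_absorb cr2 (by rw [hx, add_assoc, hf])
  have hρx : ρ (x + inv x) x :=
    hρ.trans (hadd _ _ _ _ (hρ.refl x) (hinv x)) (hidem x)
  have h₁ : ρ (x + inv x + e) x := by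
    refine hρ.trans (hadd _ _ _ _ hρx (hρ.refl e)) (hρ.trans (hcomm _ _) ?_)
    rw [hx, ← add_assoc, he]
    exact hρ.refl _
  have h₂ : ρ (f + (x + inv x)) x := by
    refine hρ.trans (hadd _ _ _ _ (hρ.refl f) hρx) (hρ.trans (hcomm _ _) ?_)
    rw [hx, add_assoc, hf]
    exact hρ.refl _
  have hg : x + inv x + e + (x + inv x + e) = x + inv x + e := by
    rw [add_assoc (x + inv x), ← add_assoc e, hex, ← add_assoc, hi]
  have hh : f + (x + inv x) + (f + (x + inv x)) = f + (x + inv x) := by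
    rw [add_assoc f, ← add_assoc (x + inv x) f, hxf, hi]
  have hr := hrect _ _ hg hh (hρ.trans h₁ (hρ.symm h₂))
  have hxx : x = x + inv x + e + (f + (x + inv x)) := by
    rw [add_assoc, ← add_assoc e, ← hx, cr2, ← add_assoc x, cr2, ← add_assoc, ← cr2,
      add_assoc (x + inv x), ← add_assoc, add_assoc (x + inv x), cr1, cr1]
  calc x + x = x + inv x + e + (f + (x + inv x)) + (x + inv x + e) + (f + (x + inv x)) := by
        rw [add_assoc (_ + (f + _)), ← hxx]
    _ = x := by rw [hr, ← hxx]

section Multiplicative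

variable {S : Type*} [AddSemigroup S] [Mul S] {inv : S → S}
  (left_distrib : ∀ a b c : S, a * (b + c) = a * b + a * c)
  (right_distrib : ∀ a b c : S, (a + b) * c = a * c + b * c)

include left_distrib in
theorem BandLE.mul_left {e f : S} (c : S) (h : BandLE e f) : BandLE (c * e) (c * f) := by
  unfold BandLE at *
  rw [← left_distrib, ← left_distrib, h]

include right_distrib in
theorem BandLE.mul_right {e f : S} (c : S) (h : BandLE e f) : BandLE (e * c) (f * c) := by
  unfold BandLE at *
  rw [← right_distrib, ← right_distrib, h]

include left_distrib right_distrib in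
theorem mul_add_inv (cr1 : ∀ x : S, x + inv x + x = x)
    (cr2 : ∀ x : S, x + inv x = inv x + x) (a b : S) :
    a * b + inv (a * b) = (a + inv a) * (b + inv b) := by
  have hl (a b : S) : a * b + inv (a * b) = a * (b + inv b) := by
    rw [left_distrib]
    exact add_eq_add_of_commuting_inverses (cr1 _)
      (by rw [← left_distrib, ← left_distrib, cr1]) (cr2 _)
      (by rw [← left_distrib, ← left_distrib, cr2])
  have hr (a b : S) : a * b + inv (a * b) = (a + inv a) * b := by
    rw [right_distrib]
    exact add_eq_add_of_commuting_inverses (cr1 _)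
      (by rw [← right_distrib, ← right_distrib, cr1]) (cr2 _)
      (by rw [← right_distrib, ← right_distrib, cr2])
  rw [← hr, ← hl, add_inv_of_idem cr1 cr2 (add_inv_add_self cr1 _)]

end Multiplicative


/-- A completely regular semiring is a band orthoring iff it is
a distributive lattice of rectangular rings: there is a congruence `ρ` whose
quotient is a distributive lattice, each of whose classes is closed under
`+`, `·`, `′` and whose additive idempotents `e`, `f` satisfy `e+f+e = e`. -/
theorem band_orthorings_stmt14
    {S : Type*} [Add S] [Mul S] (inv : S → S)
    (add_assoc : ∀ a b c : S, a + b + c = a + (b + c))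
    (mul_assoc : ∀ a b c : S, a * b * c = a * (b * c))
    (left_distrib : ∀ a b c : S, a * (b + c) = a * b + a * c)
    (right_distrib : ∀ a b c : S, (a + b) * c = a * c + b * c)
    (cr1 : ∀ x : S, x + inv x + x = x)
    (cr2 : ∀ x : S, x + inv x = inv x + x)
    (cr3 : ∀ x : S, inv (inv x) = x)
    (cr4 : ∀ x y : S,
      x + (y + inv y) + (x + inv x) + y = (x + inv x) + y + x + (y + inv y))
    (cr5 : ∀ x : S, x * (x + inv x) = x + inv x) :
    -- S is a band orthoring: E⁺(S) is closed under + and · and is a band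
    -- semiring
    ((∀ e f : S, e + e = e → f + f = f →
        ((e + f) + (e + f) = e + f ∧ (e * f) + (e * f) = e * f)) ∧
      (∀ e f : S, e + e = e → f + f = f →
        (e + e * f + e = e ∧ e + f * e + e = e))) ↔
      -- S is a distributive lattice of rectangular rings
      ∃ ρ : S → S → Prop,
        Equivalence ρ ∧
        (∀ a b c d : S, ρ a b → ρ c d → ρ (a + c) (b + d) ∧ ρ (a * c) (b * d)) ∧
        -- the quotient is a distributive lattice
        (∀ a : S, ρ (a + a) a) ∧ (∀ a : S, ρ (a * a) a) ∧
        (∀ a b : S, ρ (a + b) (b + a)) ∧ (∀ a b : S, ρ (a * b) (b * a)) ∧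
        (∀ a b : S, ρ (a + a * b) a) ∧
        -- each ρ-class is closed under +, · and ′
        (∀ a b : S, ρ a b → ρ (a + b) a ∧ ρ (a * b) a) ∧
        (∀ a : S, ρ (inv a) a) ∧
        -- the additive idempotents of each ρ-class form a rectangular band
        (∀ e f : S, e + e = e → f + f = f → ρ e f → e + f + e = e) := by
  let _ : AddSemigroup S := { add_assoc := add_assoc }
  have hi := add_inv_add_self cr1
  have hid {e : S} (he : e + e = e) : e + inv e = e := add_inv_of_idem cr1 cr2 he
  have hmulE (e f : S) (hf : f + f = f) : e * f + e * f = e * f := by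
    rw [← left_distrib, hf]
  constructor
  · rintro ⟨hcl, hband⟩
    have hE (e f : S) (he : e + e = e) (hf : f + f = f) := (hcl e f he hf).1
    have hmi := mul_add_inv left_distrib right_distrib cr1 cr2
    have hsq {e : S} (he : e + e = e) : e * e = e := by
      simpa only [hid he] using cr5 e
    let o : S → S := fun x => x + inv x
    have hio (x : S) : o x + o x = o x := hi x
    have hoo (a b : S) : o a + o b + (o a + o b) = o a + o b := hE _ _ (hio a) (hio b)
    have hsum (a b : S) : BandLE (o (a + b)) (o a + o b) ∧ BandLE (o a + o b) (o (a + b)) :=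
      add_inv_bandLE cr1 cr2 hE a b
    have hprod (a b : S) : o (a * b) = o a * o b := hmi a b
    have hoinv (a : S) : o (inv a) = o a := by
      change inv a + inv (inv a) = a + inv a
      rw [cr3, cr2]
    have hle {e f g : S} (he : e + e = e) (hf : f + f = f) (hg : g + g = g)
        (h₁ : BandLE e f) (h₂ : BandLE f g) : BandLE e g := h₁.trans hE he hf hg h₂
    have hmono {e f g h : S} (he : e + e = e) (hf : f + f = f) (hg : g + g = g)
        (hh : h + h = h) (h₁ : BandLE e f) (h₂ : BandLE g h) : BandLE (e + g) (f + h) :=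
      have heg := hE e g he hg
      .add hE hf hh heg (hle heg he hf (.add_le_left he heg) h₁)
        (hle heg hg hh (.add_le_right hg heg) h₂)
    have hcomm {e f : S} (he : e + e = e) (hf : f + f = f) : BandLE (e + f) (f + e) :=
      have hef := hE e f he hf
      .add hE hf he hef (.add_le_right hf hef) (.add_le_left he hef)
    have hmcomm {e f : S} (he : e + e = e) (hf : f + f = f) : BandLE (e * f) (f * e) := by
      have h₁ : BandLE (e * f) (f * (e * f)) := (hband _ _ (hmulE e f hf) hf).2
      have h₂ : BandLE (f * (e * f)) (f * (e * f) * e) :=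
        (hband _ _ (hmulE _ _ (hmulE e f hf)) he).1
      have h₃ : f * (e * f) * e = f * e := by
        rw [← mul_assoc, mul_assoc, hsq (hmulE f e he)]
      rw [h₃] at h₂
      exact hle (hmulE e f hf) (hmulE _ _ (hmulE e f hf)) (hmulE f e he) h₁ h₂
    have hmmono {e f g h : S} (hf : f + f = f) (hg : g + g = g)
        (hh : h + h = h) (h₁ : BandLE e f) (h₂ : BandLE g h) : BandLE (e * g) (f * h) :=
      hle (hmulE e g hg) (hmulE f g hg) (hmulE f h hh) (h₁.mul_right right_distrib g)
        (h₂.mul_left left_distrib f)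
    have hadd {a b c d : S} (h₁ : BandLE (o a) (o b)) (h₂ : BandLE (o c) (o d)) :
        BandLE (o (a + c)) (o (b + d)) :=
      hle (hio _) (hoo b d) (hio _)
        (hle (hio _) (hoo a c) (hoo b d) (hsum a c).1
          (hmono (hio a) (hio b) (hio c) (hio d) h₁ h₂)) (hsum b d).2
    have hmul {a b c d : S} (h₁ : BandLE (o a) (o b)) (h₂ : BandLE (o c) (o d)) :
        BandLE (o (a * c)) (o (b * d)) := by
      rw [hprod, hprod]
      exact hmmono (hio b) (hio c) (hio d) h₁ h₂
    have hadd_self (a : S) : BandLE (o (a + a)) (o a) ∧ BandLE (o a) (o (a + a)) := by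
      simpa only [hio] using hsum a a
    have hmul_self (a : S) : o (a * a) = o a := by rw [hprod, hsq (hio a)]
    have hrefl (a : S) : BandLE (o a) (o a) := .refl (hio a)
    have htrans {a b c : S} (h₁ : BandLE (o a) (o b)) (h₂ : BandLE (o b) (o c)) :
        BandLE (o a) (o c) := hle (hio a) (hio b) (hio c) h₁ h₂
    have hac (a b : S) : BandLE (o (a + b)) (o (b + a)) :=
      hle (hio _) (hoo b a) (hio _)
        (hle (hio _) (hoo a b) (hoo b a) (hsum a b).1 (hcomm (hio a) (hio b))) (hsum b a).2
    have hmc (a b : S) : BandLE (o (a * b)) (o (b * a)) := by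
      rw [hprod, hprod]
      exact hmcomm (hio a) (hio b)
    have habs (a b : S) : BandLE (o (a + a * b)) (o a) ∧ BandLE (o a) (o (a + a * b)) := by
      have hs := hoo a (a * b)
      refine ⟨hle (hio _) hs (hio _) (hsum _ _).1 (.add_le_left (hio a) hs),
        hle (hio _) hs (hio _) (.add hE (hio _) (hio _) (hio _) (hrefl a) ?_) (hsum _ _).2⟩
      rw [hprod]
      exact (hband _ _ (hio a) (hio b)).1
    refine ⟨fun a b => BandLE (o a) (o b) ∧ BandLE (o b) (o a),
      ⟨fun a => ⟨hrefl a, hrefl a⟩, fun h => ⟨h.2, h.1⟩,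
        fun h₁ h₂ => ⟨htrans h₁.1 h₂.1, htrans h₂.2 h₁.2⟩⟩,
      fun a b c d h₁ h₂ => ⟨⟨hadd h₁.1 h₂.1, hadd h₁.2 h₂.2⟩, hmul h₁.1 h₂.1, hmul h₁.2 h₂.2⟩,
      hadd_self, ?_, fun a b => ⟨hac a b, hac b a⟩, fun a b => ⟨hmc a b, hmc b a⟩, habs,
      ?_, ?_, ?_⟩
    · intro a
      simp only [hmul_self]
      exact ⟨hrefl a, hrefl a⟩
    · intro a b h
      refine ⟨⟨htrans (hadd (hrefl a) h.2) (hadd_self a).1,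
        htrans (hadd_self a).2 (hadd (hrefl a) h.1)⟩, ?_, ?_⟩
      · simpa only [hmul_self] using hmul (hrefl a) h.2
      · simpa only [hmul_self] using hmul (hrefl a) h.1
    · intro a
      simp only [hoinv]
      exact ⟨hrefl a, hrefl a⟩
    · intro e f he hf h
      have h' : BandLE (e + inv e) (f + inv f) := h.1
      rwa [hid he, hid hf] at h'
  · rintro ⟨ρ, hρ, hcong, hidem, -, hcomm, hmcomm, habs, -, hinv, hrect⟩
    have hE {e f : S} (he : e + e = e) (hf : f + f = f) : (e + f) + (e + f) = e + f :=
      add_idem_of_semilattice cr1 cr2 hρ (fun a b c d h₁ h₂ => (hcong a b c d h₁ h₂).1)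
        hcomm hidem hinv hrect he hf
    have key {e g : S} (he : e + e = e) (hg : g + g = g) (h : ρ (e + g) e) :
        e + g + e = e := by
      have := hrect e (e + g) he (hE he hg) (hρ.symm h)
      rwa [← add_assoc, he] at this
    refine ⟨fun e f he hf => ⟨hE he hf, hmulE e f hf⟩, fun e f he hf =>
      ⟨key he (hmulE e f hf) (habs e f), key he (hmulE f e he) ?_⟩⟩
    exact hρ.trans (hcong _ _ _ _ (hρ.refl e) (hmcomm f e)).1 (habs e f)
end

section
/- Every band orthoring S is a spined product of a left band orthoring and a right band orthoring with respect to a weak Clifford semiring; that is, there exist a left band orthoring S₁, a right band orthoring S₂, a weak Clifford semiring T, surjective homomorphisms φ₁ : S₁ → T and φ₂ : S₂ → T, and a bijection from S onto {(a,b) ∈ S₁ × S₂ : φ₁(a) = φ₂(b)} preserving + and ·. -/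
universe u

/-- A bundled completely regular semiring: a semiring (two semigroup
operations with both distributive laws) together with a unary operation `inv`
satisfying the five defining identities (with `x° := x + inv x`). -/
structure RawCRSemiring : Type (u + 1) where
  carrier : Type u
  add : carrier → carrier → carrier
  mul : carrier → carrier → carrier
  inv : carrier → carrier
  add_assoc : ∀ a b c, add (add a b) c = add a (add b c)
  mul_assoc : ∀ a b c, mul (mul a b) c = mul a (mul b c)
  left_distrib : ∀ a b c, mul a (add b c) = add (mul a b) (mul a c)
  right_distrib : ∀ a b c, mul (add a b) c = add (mul a c) (mul b c)
  cr1 : ∀ x, add (add x (inv x)) x = x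
  cr2 : ∀ x, add x (inv x) = add (inv x) x
  cr3 : ∀ x, inv (inv x) = x
  cr4 : ∀ x y, add (add (add x (add y (inv y))) (add x (inv x))) y =
      add (add (add (add x (inv x)) y) x) (add y (inv y))
  cr5 : ∀ x, mul x (add x (inv x)) = add x (inv x)

/-- An orthoring: the additive idempotents are closed under `+` and `·`. -/
def RawCRSemiring.IsOrthoring (A : RawCRSemiring.{u}) : Prop :=
  ∀ e f, A.add e e = e → A.add f f = f →
    (A.add (A.add e f) (A.add e f) = A.add e f ∧
      A.add (A.mul e f) (A.mul e f) = A.mul e f)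

/-- A left band orthoring: an orthoring with `e = e + fef` on `E⁺`. -/
def RawCRSemiring.IsLeftBandOrthoring (A : RawCRSemiring.{u}) : Prop :=
  A.IsOrthoring ∧
    ∀ e f, A.add e e = e → A.add f f = f →
      e = A.add e (A.mul (A.mul f e) f)

/-- A right band orthoring: an orthoring with `e = fef + e` on `E⁺`. -/
def RawCRSemiring.IsRightBandOrthoring (A : RawCRSemiring.{u}) : Prop :=
  A.IsOrthoring ∧
    ∀ e f, A.add e e = e → A.add f f = f →
      e = A.add (A.mul (A.mul f e) f) e

/-- A weak Clifford semiring: a completely regular semiring with commutative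
addition satisfying `a(a+a′) = a+a′`, `a(b+b′) = (b+b′)a` and
`a + a(b+b′) = a`. -/
def RawCRSemiring.IsWeakClifford (A : RawCRSemiring.{u}) : Prop :=
  (∀ a b, A.add a b = A.add b a) ∧
    (∀ a, A.mul a (A.add a (A.inv a)) = A.add a (A.inv a)) ∧
    (∀ a b, A.mul a (A.add b (A.inv b)) = A.mul (A.add b (A.inv b)) a) ∧
    (∀ a b, A.add a (A.mul a (A.add b (A.inv b))) = a)

/-- A band orthoring, as a class on its carrier; `pinv` is the additive inverse `x′`. -/
class BandOrthoring (S : Type u) extends AddSemigroup S, Semigroup S, Distrib S where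
  pinv : S → S
  add_pinv_add : ∀ x : S, x + pinv x + x = x
  add_pinv_comm : ∀ x : S, x + pinv x = pinv x + x
  pinv_pinv : ∀ x : S, pinv (pinv x) = x
  add_zero_swap : ∀ x y : S,
    x + (y + pinv y) + (x + pinv x) + y = (x + pinv x) + y + x + (y + pinv y)
  mul_add_pinv : ∀ x : S, x * (x + pinv x) = x + pinv x
  idem_add : ∀ e f : S, e + e = e → f + f = f → (e + f) + (e + f) = e + f
  idem_mul : ∀ e f : S, e + e = e → f + f = f → e * f + e * f = e * f
  idem_absorb_right : ∀ e f : S, e + e = e → f + f = f → e + e * f + e = e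
  idem_absorb_left : ∀ e f : S, e + e = e → f + f = f → e + f * e + e = e

namespace BandOrthoring

variable {S : Type u}

/-- If `x` absorbs `y` and `z` in a band, it absorbs their product. -/
theorem absorb_add [AddSemigroup S] {x y z : S} (hi : (y + x + z) + (y + x + z) = y + x + z)
    (hy : x + y + x = x) (hz : x + z + x = x) : x + z + y + x = x := by
  grind

theorem absorb_trans [AddSemigroup S] {x y z : S} (h1 : (x + (y + z)) + (x + (y + z)) = x + (y + z))
    (h2 : (z + x) + (z + x) = z + x)
    (hy : x + y + x = x) (hz : y + z + y = y) : x + z + x = x := by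
  have h : x + (y + z) + y + x = x := by grind
  have h' : x + (y + z) + x = x := by grind
  grind

variable [BandOrthoring S]

/-- The idempotent `x°` of the additive subgroup containing `x`. -/
def deg (x : S) : S := x + pinv x

theorem deg_def (x : S) : deg x = x + pinv x := rfl

theorem deg_add_self (x : S) : deg x + x = x := add_pinv_add x

theorem add_deg_self (x : S) : x + deg x = x := by
  have h := add_pinv_add x
  rw [deg, add_pinv_comm, ← add_assoc]
  exact h

theorem deg_idem (x : S) : deg x + deg x = deg x := by
  have h := deg_add_self x
  simp only [deg] at *
  grind

theorem pinv_add (x : S) : pinv x + x = deg x := (add_pinv_comm x).symm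

theorem deg_pinv (x : S) : deg (pinv x) = deg x := by
  rw [deg, pinv_pinv, pinv_add]

theorem swap (x y : S) : x + deg y + deg x + y = deg x + y + x + deg y :=
  add_zero_swap x y

theorem deg_eq {u v h : S} (hvu : v + u = h) (hu : h + u = u) : deg u = h := by
  have h1 := add_deg_self u
  have h3 : h + deg u = deg u := by rw [deg_def, ← add_assoc, hu]
  rw [← h3, ← hvu, add_assoc, h1]

theorem pinv_eq {u v h : S} (hvu : v + u = h) (hu : h + u = u)
    (hv : v + h = v) : pinv u = v := by
  have h1 := deg_eq hvu hu
  have h3 := deg_add_self (pinv u)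
  rw [deg_pinv, h1, ← hvu, add_assoc, ← deg_def, h1, hv] at h3
  exact h3.symm

theorem deg_of_idem {e : S} (he : e + e = e) : deg e = e := deg_eq he he

theorem deg_deg (x : S) : deg (deg x) = deg x := deg_of_idem (deg_idem x)

theorem mul_self {e : S} (he : e + e = e) : e * e = e := by
  have h := mul_add_pinv e
  rwa [← deg_def, deg_of_idem he] at h

theorem deg_mul_right (x y : S) : deg (x * y) = x * deg y := by
  refine deg_eq (v := x * pinv y) ?_ ?_
  · rw [← mul_add, pinv_add]
  · rw [← mul_add, deg_add_self]

theorem deg_mul_left (x y : S) : deg (x * y) = deg x * y := by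
  refine deg_eq (v := pinv x * y) ?_ ?_
  · rw [← add_mul, pinv_add]
  · rw [← add_mul, deg_add_self]

theorem deg_mul (x y : S) : deg (x * y) = deg x * deg y := by
  rw [← deg_deg, deg_mul_right, deg_mul_left]

instance : BandOrthoring Sᵃᵒᵖ where
  left_distrib a b c := congrArg AddOpposite.op (mul_add a.unop c.unop b.unop)
  right_distrib a b c := congrArg AddOpposite.op (add_mul b.unop a.unop c.unop)
  pinv x := .op (pinv x.unop)
  add_pinv_add x := congrArg AddOpposite.op ((add_assoc _ _ _).symm.trans (add_pinv_add x.unop))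
  add_pinv_comm x := congrArg AddOpposite.op (add_pinv_comm x.unop).symm
  pinv_pinv x := congrArg AddOpposite.op (pinv_pinv x.unop)
  add_zero_swap x y := by
    apply AddOpposite.unop_injective
    have h := add_zero_swap y.unop x.unop
    have hx := add_pinv_comm x.unop
    have hy := add_pinv_comm y.unop
    simp only [AddOpposite.unop_add, AddOpposite.unop_op, ← hx, ← hy]
    simpa only [add_assoc] using h
  mul_add_pinv x := by
    apply AddOpposite.unop_injective
    have h := mul_add_pinv x.unop
    have hx := add_pinv_comm x.unop
    simp only [AddOpposite.unop_add, AddOpposite.unop_mul, AddOpposite.unop_op]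
    rw [← hx, h]
  idem_add e f he hf := congrArg AddOpposite.op
    (idem_add f.unop e.unop (congrArg AddOpposite.unop hf) (congrArg AddOpposite.unop he))
  idem_mul e f he hf := congrArg AddOpposite.op
    (idem_mul e.unop f.unop (congrArg AddOpposite.unop he) (congrArg AddOpposite.unop hf))
  idem_absorb_right e f he hf := congrArg AddOpposite.op ((add_assoc _ _ _).symm.trans
    (idem_absorb_right e.unop f.unop (congrArg AddOpposite.unop he) (congrArg AddOpposite.unop hf)))
  idem_absorb_left e f he hf := congrArg AddOpposite.op ((add_assoc _ _ _).symm.trans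
    (idem_absorb_left e.unop f.unop (congrArg AddOpposite.unop he) (congrArg AddOpposite.unop hf)))

theorem op_deg (x : S) : deg (AddOpposite.op x) = AddOpposite.op (deg x) :=
  congrArg AddOpposite.op (pinv_add x)

theorem deg_idem_add {e : S} (he : e + e = e) (x : S) : deg (e + x) = e + deg x := by
  have h3 := idem_add e (deg x) he (deg_idem x)
  have hl : ∀ z : S, deg z = deg x → e + deg x + e + z = e + z := fun z hz => by
    have := deg_add_self z
    rw [hz] at this
    grind
  have hr : ∀ z : S, deg z = deg x → e + z + e + deg x = e + z := fun z hz => by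
    have h4 := swap e z
    rw [deg_of_idem he, hz, hl z hz] at h4
    exact h4.symm
  refine deg_eq (v := e + pinv x) ?_ ?_
  · have h1 := hr (pinv x) (deg_pinv x)
    have h2 := deg_add_self x
    have h5 := pinv_add x
    calc e + pinv x + (e + x) = (e + pinv x + e + deg x) + x := by
            simp only [add_assoc, h2]
      _ = e + deg x := by rw [h1, add_assoc, h5]
  · rw [← hl x rfl]
    grind

theorem deg_add_idem {e : S} (he : e + e = e) (x : S) : deg (x + e) = deg x + e := by
  have h := deg_idem_add (e := AddOpposite.op e) (congrArg AddOpposite.op he) (.op x)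
  rw [← AddOpposite.op_add, op_deg, op_deg, ← AddOpposite.op_add] at h
  exact AddOpposite.op_injective h

theorem add_idem_add_pinv {e : S} (he : e + e = e) (x : S) :
    x + e + pinv x = deg x + e + deg x := by
  have h2 : deg x + e + (x + e) = x + e := by
    rw [← deg_add_idem he x, deg_add_self]
  have h4 : e + pinv x + (e + deg x) = e + pinv x := by
    rw [← deg_pinv x, ← deg_idem_add he, add_deg_self]
  have h5 : e + x + (e + deg x) = e + x := by
    rw [← deg_idem_add he, add_deg_self]
  have h6 : e + x + (e + pinv x) = e + deg x := by
    have h7 := deg_add_self (pinv x)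
    rw [deg_pinv] at h7
    rw [← h7, ← add_assoc e, ← add_assoc, h5, add_assoc, deg_def]
  have h7 := idem_add _ _ he (deg_idem x)
  calc x + e + pinv x = x + (e + pinv x + (e + deg x)) := by rw [h4, add_assoc]
    _ = (deg x + e + (x + e)) + pinv x + e + deg x := by rw [h2]; simp only [add_assoc]
    _ = deg x + (e + x + (e + pinv x)) + e + deg x := by simp only [add_assoc]
    _ = deg x + (e + deg x + (e + deg x)) := by rw [h6]; simp only [add_assoc]
    _ = deg x + e + deg x := by rw [h7, add_assoc]

theorem pinv_add_idem_add {e : S} (he : e + e = e) (x : S) :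
    pinv x + e + x = deg x + e + deg x := by
  have h := add_idem_add_pinv he (pinv x)
  rwa [pinv_pinv, deg_pinv] at h

theorem deg_add (x y : S) : deg (x + y) = deg x + deg y := by
  have hx := deg_idem x
  have hy := deg_idem y
  have h := idem_add _ _ hx hy
  have h1 := pinv_add_idem_add hy x
  have h2 := pinv_add_idem_add (idem_add _ _ h hx) y
  have h3 : deg x + deg y + (x + deg y) = x + deg y := by
    rw [← deg_add_idem hy x, deg_add_self]
  refine deg_eq (v := deg x + pinv y + (pinv x + deg y)) ?_ ?_
  · calc deg x + pinv y + (pinv x + deg y) + (x + y)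
        = deg x + (pinv y + (pinv x + deg y + x) + y) := by simp only [add_assoc]
      _ = deg x + deg y + (deg x + deg y) + (deg x + deg y) := by
        rw [h1, h2]; simp only [add_assoc]
      _ = deg x + deg y := by rw [h, h]
  · calc deg x + deg y + (x + y) = deg x + deg y + (x + deg y) + y := by
          rw [add_assoc _ (x + deg y), add_assoc x, deg_add_self]
      _ = x + y := by rw [h3, add_assoc, deg_add_self]

theorem absorb_mul_comm {e f : S} (he : e + e = e) (hf : f + f = f) :
    e * f + f * e + e * f = e * f := by
  have hef := idem_mul _ _ he hf
  have hfe := idem_mul _ _ hf he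
  have hfef := idem_mul _ _ hf hef
  have h1 := idem_absorb_left _ _ hef hf
  have h2 := idem_absorb_right _ _ hfef he
  have h3 : f * (e * f) * e = f * e := by
    rw [← mul_assoc f, mul_assoc, mul_self hfe]
  rw [h3] at h2
  exact absorb_trans (idem_add _ _ hef (idem_add _ _ hfef hfe))
    (idem_add _ _ hfe hef) h1 h2

theorem absorb_mul_mul {e f : S} (he : e + e = e) (hf : f + f = f) :
    e + f * e * f + e = e := by
  have hfe := idem_mul _ _ hf he
  have hfef := idem_mul _ _ hfe hf
  exact absorb_trans (idem_add _ _ he (idem_add _ _ hfe hfef))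
    (idem_add _ _ hfef he) (idem_absorb_left _ _ he hf) (idem_absorb_right _ _ hfe hf)

/-- Green's relation `D` on the additive idempotents. -/
structure IdemD (x y : S) : Prop where
  left_idem : x + x = x
  right_idem : y + y = y
  left_absorb : x + y + x = x
  right_absorb : y + x + y = y

theorem IdemD.symm {x y : S} (h : IdemD x y) : IdemD y x :=
  ⟨h.2, h.1, h.4, h.3⟩

theorem IdemD.trans {x y z : S} (h : IdemD x y) (h' : IdemD y z) : IdemD x z where
  left_idem := h.1
  right_idem := h'.2
  left_absorb := absorb_trans (idem_add _ _ h.1 (idem_add _ _ h'.1 h'.2))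
    (idem_add _ _ h'.2 h.1) h.3 h'.3
  right_absorb := absorb_trans (idem_add _ _ h'.2 (idem_add _ _ h.2 h.1))
    (idem_add _ _ h.1 h'.2) h'.4 h.4

/-- In a rectangular band the middle summand is redundant. -/
theorem IdemD.add_add {x y z : S} (hy : IdemD x y) (hz : IdemD x z) :
    x + y + z = x + z := by
  have h := absorb_add (idem_add _ _ (idem_add _ _ hz.2 hz.1) hy.2) hz.3 hy.3
  calc x + y + z = x + y + z + x + z := by
        rw [add_assoc _ x z, add_assoc _ z, ← add_assoc z, hz.4]
    _ = x + z := by rw [h]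

theorem idemD_mul_right {e d : S} (he : e + e = e) (hd : d + d = d) (h : d + e + d = d) :
    IdemD e (e * d) where
  left_idem := he
  right_idem := idem_mul _ _ he hd
  left_absorb := idem_absorb_right _ _ he hd
  right_absorb := by
    have := congrArg (e * ·) h
    simpa only [mul_add, mul_self he] using this

theorem idemD_mul_left {e d : S} (he : e + e = e) (hd : d + d = d) (h : d + e + d = d) :
    IdemD e (d * e) where
  left_idem := he
  right_idem := idem_mul _ _ hd he
  left_absorb := idem_absorb_left _ _ he hd
  right_absorb := by
    have := congrArg (· * e) h
    simpa only [add_mul, mul_self he] using this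

/-- Idempotents with `e + f = f` and `f + e = e` act in the same way on idempotents
below them. -/
theorem add_eq_of_absorb {e f d : S} (he : e + e = e) (hf : f + f = f) (hd : d + d = d)
    (h1 : e + f = f) (h2 : f + e = e) (hed : d + e + d = d) (hfd : d + f + d = d) :
    e + d = f + d := by
  have hee := mul_self he
  have hff := mul_self hf
  have hdd := mul_self hd
  have Def : IdemD e f := ⟨he, hf, by rw [h1, h2], by rw [h2, h1]⟩
  have D1 : IdemD e (e * f) := idemD_mul_right he hf Def.4
  have D2 : IdemD e (e * d) := idemD_mul_right he hd hed
  have D3 : IdemD e (d * e) := idemD_mul_left he hd hed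
  have D4 : IdemD f (f * d) := idemD_mul_right hf hd hfd
  have D5 : IdemD f (d * f) := idemD_mul_left hf hd hfd
  have D6 : IdemD (e * f) (e * d) := D1.symm.trans D2
  have D7 : IdemD (e * f) (d * f) := (D1.symm.trans Def).trans D5
  have D8 : IdemD f (e * f) := Def.symm.trans D1
  have h3 : e + e * f = e * f := by
    have := congrArg (e * ·) h1
    simpa only [mul_add, hee] using this
  have h4 : f + e * f = e * f := by rw [← h3, ← add_assoc, h2]
  have h5 : e * f + e * d = e + e * d := by rw [← D1.add_add D2, h3]
  have h6 : e * f + d * f = f + d * f := by rw [← D8.add_add D5, h4]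
  have h7 : (e + d) * (f + d) = e + e * d + d := by
    rw [mul_add, add_mul, add_mul, ← add_assoc, D7.add_add D6, h5, hdd]
  have h8 : (e + d) * (f + d) = f + d * f + d := by
    rw [add_mul, mul_add, mul_add, ← add_assoc, D6.add_add D7, h6, hdd]
  have h9 : e + d = e + e * d + d := by
    have := mul_self (idem_add _ _ he hd)
    rw [← this, mul_add, add_mul, add_mul, ← add_assoc, hee, hdd, D3.add_add D2]
  have h10 : f + d = f + d * f + d := by
    have := mul_self (idem_add _ _ hf hd)
    rw [← this, add_mul, mul_add, mul_add, ← add_assoc, hff, hdd, D4.add_add D5]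
  rw [h9, h10, ← h7, ← h8]

/-- Green's relation `R` on additive idempotents is compatible with addition on the right. -/
theorem add_add_add_of_absorb {e f c : S} (he : e + e = e) (hf : f + f = f) (hc : c + c = c)
    (h1 : e + f = f) (h2 : f + e = e) : f + c + (e + c) = e + c := by
  have hec := idem_add _ _ he hc
  have hce := idem_add _ _ hc he
  have hd := idem_add _ _ hc hec
  have hed : c + (e + c) + e + (c + (e + c)) = c + (e + c) := by
    calc _ = (c + e) + (c + e) + (c + e) + c := by simp only [add_assoc]
      _ = _ := by rw [hce, hce, add_assoc]
  have hfd : c + (e + c) + f + (c + (e + c)) = c + (e + c) :=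
    absorb_trans (idem_add _ _ hd (idem_add _ _ he hf)) (idem_add _ _ hf hd) hed
      (by rw [h1, h2])
  have := add_eq_of_absorb he hf hd h1 h2 hed hfd
  calc f + c + (e + c) = f + (c + (e + c)) := add_assoc _ _ _
    _ = e + c + (e + c) := by rw [← this, add_assoc]
    _ = e + c := hec

/-- Equality of the subgroup and `R` coordinates. -/
def RelL (a b : S) : Prop := a = b + deg a ∧ b = a + deg b

/-- Equality of the subgroup and `L` coordinates. -/
def RelR (a b : S) : Prop := a = deg a + b ∧ b = deg b + a

theorem relL_op {a b : S} : RelL (AddOpposite.op a) (AddOpposite.op b) ↔ RelR a b := by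
  simp only [RelL, RelR, op_deg, ← AddOpposite.op_add, AddOpposite.op_inj]

theorem RelL.refl (a : S) : RelL a a := ⟨(add_deg_self a).symm, (add_deg_self a).symm⟩

theorem RelL.symm {a b : S} (h : RelL a b) : RelL b a := ⟨h.2, h.1⟩

theorem RelL.deg_eq {a b : S} (h : RelL a b) : deg b + deg a = deg a := by
  rw [← deg_deg a, ← deg_add, deg_deg, ← h.1]

theorem RelL.trans {a b c : S} (h : RelL a b) (h' : RelL b c) : RelL a c where
  left := by
    have h1 := h.1
    rw [h'.1, add_assoc, h.deg_eq] at h1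
    exact h1
  right := by
    have h1 := h'.2
    rw [h.2, add_assoc, h'.symm.deg_eq] at h1
    exact h1

theorem RelL.mul_left {a b : S} (h : RelL a b) (c : S) : RelL (c * a) (c * b) := by
  simp only [RelL, deg_mul_right, ← mul_add]
  exact ⟨congrArg _ h.1, congrArg _ h.2⟩

theorem RelL.mul_right {a b : S} (h : RelL a b) (c : S) : RelL (a * c) (b * c) := by
  simp only [RelL, deg_mul_left, ← add_mul]
  exact ⟨congrArg (· * c) h.1, congrArg (· * c) h.2⟩

theorem RelL.add_left {a b : S} (h : RelL a b) (c : S) : RelL (c + a) (c + b) := by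
  have key : ∀ {a b : S}, RelL a b → c + a = c + b + deg (c + a) := fun {a b} h => by
    have h1 := add_deg_self (c + b)
    have h2 := h.deg_eq
    have h3 := h.1
    rw [deg_add] at *
    calc c + a = c + b + deg a := by rw [add_assoc, ← h3]
      _ = c + b + (deg c + (deg b + deg a)) := by
        rw [← add_assoc (deg c), ← add_assoc, h1]
      _ = _ := by rw [h2]
  exact ⟨key h, key h.symm⟩

theorem RelL.add_right {a b : S} (h : RelL a b) (c : S) : RelL (a + c) (b + c) := by
  have key : ∀ {a b : S}, RelL a b → a + c = b + c + deg (a + c) := fun {a b} h => by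
    have h1 := h.symm.deg_eq
    have h2 := h.deg_eq
    have h3 := add_add_add_of_absorb (deg_idem a) (deg_idem b) (deg_idem c) h1 h2
    have hb := add_deg_self b
    have h4 := swap c (deg a)
    rw [deg_deg] at h4
    have h5 := add_deg_self (deg a + c)
    rw [deg_add, deg_deg] at h5
    have h6 := idem_add _ _ (deg_idem a) (deg_idem c)
    have h7 := deg_add_self c
    have h8 : deg b + c + (deg a + deg c) = deg a + c := by
      calc deg b + c + (deg a + deg c)
          = deg b + (c + deg a + deg c + deg a) + deg c := by
            simp only [add_assoc] at h6 ⊢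
            rw [h6]
        _ = (deg b + deg c + (deg a + (deg c + c)) + (deg a + deg c)) := by
            rw [h4, h7]; simp only [add_assoc]
        _ = (deg b + deg c + (deg a + deg c)) + c + (deg a + deg c) := by
            simp only [add_assoc]
        _ = deg a + c := by rw [h3, add_assoc _ _ c, h7, h5]
    rw [deg_add]
    calc a + c = b + (deg a + c) := by rw [← add_assoc, ← h.1]
      _ = b + deg b + c + (deg a + deg c) := by rw [← h8]; simp only [add_assoc]
      _ = _ := by rw [hb]
  exact ⟨key h, key h.symm⟩

theorem RelL.add {a b c d : S} (h : RelL a b) (h' : RelL c d) : RelL (a + c) (b + d) :=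
  (h.add_right c).trans (h'.add_left b)

theorem RelL.mul {a b c d : S} (h : RelL a b) (h' : RelL c d) : RelL (a * c) (b * d) :=
  (h.mul_right c).trans (h'.mul_left b)

theorem RelL.pinv {a b : S} (h : RelL a b) : RelL (pinv a) (pinv b) := by
  have key : ∀ {a b : S}, RelL a b → BandOrthoring.pinv a = BandOrthoring.pinv b + deg a :=
      fun {a b} h => by
    have h1 := h.symm.deg_eq
    have h2 := h.deg_eq
    have h3 : deg a + b = b := by rw [← deg_add_self b, ← add_assoc, h1]
    refine pinv_eq (h := deg a) ?_ (deg_add_self a) ?_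
    · calc BandOrthoring.pinv b + deg a + a = BandOrthoring.pinv b + (deg a + b) + deg a := by
            rw [add_assoc, add_assoc, add_assoc, ← h.1]
        _ = deg a := by rw [h3, pinv_add, h2]
    · rw [add_assoc, deg_idem]
  simp only [RelL, deg_pinv]
  exact ⟨key h, key h.symm⟩

theorem RelL.idem {a : S} (h : RelL (a + a) a) : a + a = a := by
  rw [h.1, deg_add, deg_idem, add_deg_self]

theorem relL_of_absorb {a b : S} (h : deg a + b + deg a = deg a) (hb : deg b = b) :
    RelL (a + b) a := by
  simp only [RelL, deg_add, hb]
  refine ⟨?_, ?_⟩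
  · rw [← add_assoc, add_deg_self]
  · calc a = a + (deg a + b + deg a) := by rw [h, add_deg_self]
      _ = a + b + deg a := by rw [← add_assoc, ← add_assoc, add_deg_self]

theorem RelR.refl (a : S) : RelR a a := relL_op.1 (.refl _)

theorem RelR.symm {a b : S} (h : RelR a b) : RelR b a := ⟨h.2, h.1⟩

theorem RelR.deg_eq {a b : S} (h : RelR a b) : deg a + deg b = deg a := by
  rw [← deg_deg a, ← deg_add, deg_deg, ← h.1]

theorem RelR.trans {a b c : S} (h : RelR a b) (h' : RelR b c) : RelR a c :=
  relL_op.1 ((relL_op.2 h).trans (relL_op.2 h'))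

theorem RelR.add {a b c d : S} (h : RelR a b) (h' : RelR c d) : RelR (a + c) (b + d) :=
  relL_op.1 ((relL_op.2 h').add (relL_op.2 h))

theorem RelR.mul {a b c d : S} (h : RelR a b) (h' : RelR c d) : RelR (a * c) (b * d) :=
  relL_op.1 ((relL_op.2 h).mul (relL_op.2 h'))

theorem RelR.pinv {a b : S} (h : RelR a b) : RelR (pinv a) (pinv b) :=
  relL_op.1 (relL_op.2 h).pinv

theorem RelR.idem {a : S} (h : RelR (a + a) a) : a + a = a := by
  rw [h.1, deg_add, deg_idem, deg_add_self]

theorem relR_of_absorb {a b : S} (h : deg a + b + deg a = deg a) (hb : deg b = b) :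
    RelR (b + a) a := by
  refine relL_op.1 (relL_of_absorb (a := AddOpposite.op a) (b := AddOpposite.op b) ?_ ?_)
  · rw [op_deg, ← AddOpposite.op_add, ← AddOpposite.op_add, ← add_assoc, h]
  · rw [op_deg, hb]

theorem RelL.eq_of_relR {a b : S} (h : RelL a b) (h' : RelR a b) : a = b := by
  have h1 := h.symm.deg_eq
  rw [h'.deg_eq] at h1
  rw [h.1, h1, add_deg_self]

theorem RelL.comm {a b c : S} (h : RelL a c) (h' : RelR c b) : ∃ d, RelR a d ∧ RelL d b := by
  have hac := h.deg_eq
  have hca := h.symm.deg_eq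
  have hcb := h'.deg_eq
  have hbc := h'.symm.deg_eq
  have ha := deg_idem a
  have hb := deg_idem b
  have hc := deg_idem c
  have D1 : IdemD (deg c) (deg a) := ⟨hc, ha, by rw [hac, hca], by rw [hca, hac]⟩
  have D2 : IdemD (deg c) (deg b) := ⟨hc, hb, by rw [hcb, hc], by rw [hbc, hb]⟩
  have D3 : IdemD (deg a) (deg b) := D1.symm.trans D2
  refine ⟨b + deg a, ⟨?_, ?_⟩, ⟨?_, ?_⟩⟩
  · calc a = deg a + deg b + deg a + a := by rw [D3.3, deg_add_self]
      _ = deg a + deg b + (a + deg c + deg a) := by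
          rw [add_assoc a, hac, add_deg_self, add_assoc, add_assoc, deg_add_self, add_assoc]
      _ = deg a + (deg b + c + deg a) := by rw [← h.2]; simp only [add_assoc]
      _ = deg a + (b + deg a) := by rw [← h'.2]
  · rw [deg_add, deg_deg, add_assoc, deg_add_self]
    calc b + deg a = deg b + (c + deg a) := by rw [← add_assoc, ← h'.2]
      _ = deg b + a := by rw [← h.1]
  · rw [deg_add, deg_deg, ← add_assoc, add_deg_self]
  · rw [add_assoc]
    calc b = b + (deg b + deg a + deg b) := by rw [D3.4, add_deg_self]
      _ = _ := by rw [← add_assoc, ← add_assoc, add_deg_self, add_assoc]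

/-- The composite of `RelL` and `RelR`. -/
def RelD (a b : S) : Prop := ∃ c, RelL a c ∧ RelR c b

theorem RelL.relD {a b : S} (h : RelL a b) : RelD a b := ⟨b, h, .refl b⟩

theorem RelR.relD {a b : S} (h : RelR a b) : RelD a b := ⟨a, .refl a, h⟩

theorem RelD.symm {a b : S} : RelD a b → RelD b a
  | ⟨_, h, h'⟩ => have ⟨d, h1, h2⟩ := h.comm h'; ⟨d, h2.symm, h1.symm⟩

theorem RelD.trans {a b c : S} : RelD a b → RelD b c → RelD a c
  | ⟨_, h1, h2⟩, ⟨_, h3, h4⟩ =>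
    have ⟨d, h5, h6⟩ := h3.symm.comm h2.symm
    ⟨d, h1.trans h6.symm, h5.symm.trans h4⟩

theorem RelD.add {a b c d : S} : RelD a b → RelD c d → RelD (a + c) (b + d)
  | ⟨_, h1, h2⟩, ⟨_, h3, h4⟩ => ⟨_, h1.add h3, h2.add h4⟩

theorem RelD.mul {a b c d : S} : RelD a b → RelD c d → RelD (a * c) (b * d)
  | ⟨_, h1, h2⟩, ⟨_, h3, h4⟩ => ⟨_, h1.mul h3, h2.mul h4⟩

theorem RelD.pinv {a b : S} : RelD a b → RelD (pinv a) (pinv b)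
  | ⟨_, h1, h2⟩ => ⟨_, h1.pinv, h2.pinv⟩

theorem relD_add_comm (a b : S) : RelD (a + b) (b + a) := by
  have hab := idem_add _ _ (deg_idem a) (deg_idem b)
  have hba := idem_add _ _ (deg_idem b) (deg_idem a)
  have h1 : a + b + (deg a + deg b) = a + b := by rw [← deg_add, add_deg_self]
  have h2 : deg a + deg b + (a + b) = a + b := by rw [← deg_add, deg_add_self]
  have h3 : b + a = deg b + a + b + deg a := by
    rw [← swap]
    calc b + a = b + deg b + (deg a + a) := by rw [add_deg_self, deg_add_self]
      _ = b + (deg b + deg a) + a := by simp only [add_assoc]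
      _ = (b + deg b) + deg a + deg b + (deg a + a) := by rw [← hba]; simp only [add_assoc]
      _ = _ := by rw [add_deg_self, deg_add_self]
  have h4 : deg a + (b + a) = a + b + deg a := by
    calc deg a + (b + a) = deg a + deg b + (deg a + a) + b + deg a := by
          rw [h3, deg_add_self]; simp only [add_assoc]
      _ = deg a + deg b + (deg a + deg b + (a + b)) + deg a := by
          rw [h2, deg_add_self]; simp only [add_assoc]
      _ = _ := by rw [h2, h2]
  refine ⟨a + b + deg a, ⟨?_, ?_⟩, ⟨?_, ?_⟩⟩
  · rw [deg_add, add_assoc _ (deg a), ← add_assoc (deg a), deg_idem, h1]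
  · rw [deg_add, deg_add, deg_deg, ← add_assoc, h1]
  · rw [deg_add, deg_add, deg_deg, ← h4, add_assoc (deg a), add_assoc (deg a), ← deg_add,
      deg_add_self]
  · rw [deg_add, ← add_assoc, ← add_assoc, add_assoc _ (deg a), deg_add_self]
    exact h3

/-- The quotient of a band orthoring by a congruence. -/
def quotient (r : Setoid S) (hadd : ∀ a b c d, r a b → r c d → r (a + c) (b + d))
    (hmul : ∀ a b c d, r a b → r c d → r (a * c) (b * d))
    (hinv : ∀ a b, r a b → r (pinv a) (pinv b)) : RawCRSemiring.{u} where
  carrier := Quotient r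
  add := Quotient.map₂ (· + ·) fun _ _ h _ _ h' => hadd _ _ _ _ h h'
  mul := Quotient.map₂ (· * ·) fun _ _ h _ _ h' => hmul _ _ _ _ h h'
  inv := Quotient.map BandOrthoring.pinv hinv
  add_assoc := by rintro ⟨a⟩ ⟨b⟩ ⟨c⟩; exact congrArg _ (add_assoc a b c)
  mul_assoc := by rintro ⟨a⟩ ⟨b⟩ ⟨c⟩; exact congrArg _ (mul_assoc a b c)
  left_distrib := by rintro ⟨a⟩ ⟨b⟩ ⟨c⟩; exact congrArg _ (mul_add a b c)
  right_distrib := by rintro ⟨a⟩ ⟨b⟩ ⟨c⟩; exact congrArg _ (add_mul a b c)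
  cr1 := by rintro ⟨a⟩; exact congrArg _ (add_pinv_add a)
  cr2 := by rintro ⟨a⟩; exact congrArg _ (add_pinv_comm a)
  cr3 := by rintro ⟨a⟩; exact congrArg _ (pinv_pinv a)
  cr4 := by rintro ⟨a⟩ ⟨b⟩; exact congrArg _ (add_zero_swap a b)
  cr5 := by rintro ⟨a⟩; exact congrArg _ (mul_add_pinv a)

variable (S) in
/-- The quotient of a band orthoring by `RelL`. -/
def leftQuotient : RawCRSemiring.{u} :=
  quotient ⟨RelL (S := S), ⟨.refl, .symm, .trans⟩⟩ (fun _ _ _ _ => .add) (fun _ _ _ _ => .mul)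
    fun _ _ => .pinv

variable (S) in
/-- The quotient of a band orthoring by `RelR`. -/
def rightQuotient : RawCRSemiring.{u} :=
  quotient ⟨RelR (S := S), ⟨.refl, .symm, .trans⟩⟩ (fun _ _ _ _ => .add) (fun _ _ _ _ => .mul)
    fun _ _ => .pinv

variable (S) in
/-- The quotient of a band orthoring by `RelD`. -/
def cliffordQuotient : RawCRSemiring.{u} :=
  quotient ⟨RelD (S := S), ⟨fun a => (RelL.refl a).relD, .symm, .trans⟩⟩
    (fun _ _ _ _ => .add) (fun _ _ _ _ => .mul) fun _ _ => .pinv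

theorem leftQuotient_isLeftBandOrthoring : (leftQuotient S).IsLeftBandOrthoring := by
  refine ⟨?_, ?_⟩
  · rintro ⟨e⟩ ⟨f⟩ he hf
    have he := (Quotient.exact he : RelL (e + e) e).idem
    have hf := (Quotient.exact hf : RelL (f + f) f).idem
    exact ⟨congrArg _ (idem_add _ _ he hf), congrArg _ (idem_mul _ _ he hf)⟩
  · rintro ⟨e⟩ ⟨f⟩ he hf
    have he := (Quotient.exact he : RelL (e + e) e).idem
    have hf := (Quotient.exact hf : RelL (f + f) f).idem
    refine Quotient.sound (relL_of_absorb ?_ ?_ : RelL (e + f * e * f) e).symm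
    · rw [deg_of_idem he, absorb_mul_mul he hf]
    · exact deg_of_idem (idem_mul _ _ (idem_mul _ _ hf he) hf)

theorem rightQuotient_isRightBandOrthoring : (rightQuotient S).IsRightBandOrthoring := by
  refine ⟨?_, ?_⟩
  · rintro ⟨e⟩ ⟨f⟩ he hf
    have he := (Quotient.exact he : RelR (e + e) e).idem
    have hf := (Quotient.exact hf : RelR (f + f) f).idem
    exact ⟨congrArg _ (idem_add _ _ he hf), congrArg _ (idem_mul _ _ he hf)⟩
  · rintro ⟨e⟩ ⟨f⟩ he hf
    have he := (Quotient.exact he : RelR (e + e) e).idem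
    have hf := (Quotient.exact hf : RelR (f + f) f).idem
    refine Quotient.sound (relR_of_absorb ?_ ?_ : RelR (f * e * f + e) e).symm
    · rw [deg_of_idem he, absorb_mul_mul he hf]
    · exact deg_of_idem (idem_mul _ _ (idem_mul _ _ hf he) hf)

theorem relD_of_absorb {e f : S} (he : deg e = e) (hf : deg f = f) (h : e + f + e = e)
    (h' : f + e + f = f) : RelD e f := by
  refine ⟨e + f, (relL_of_absorb ?_ hf).symm, relR_of_absorb ?_ he⟩
  · rw [he, h]
  · rw [hf, h']

theorem cliffordQuotient_isWeakClifford : (cliffordQuotient S).IsWeakClifford := by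
  refine ⟨?_, ?_, ?_, ?_⟩
  · rintro ⟨a⟩ ⟨b⟩
    exact Quotient.sound (relD_add_comm a b)
  · rintro ⟨a⟩
    exact congrArg _ (mul_add_pinv a)
  · rintro ⟨a⟩ ⟨b⟩
    have ha := deg_idem a
    have hb := deg_idem b
    refine Quotient.sound (?_ : RelD (a * deg b) (deg b * a))
    rw [← deg_mul_right, ← deg_mul_left, deg_mul, deg_mul]
    refine relD_of_absorb ?_ ?_ (absorb_mul_comm ha hb) (absorb_mul_comm hb ha) <;>
      rw [deg_mul, deg_deg, deg_deg]
  · rintro ⟨a⟩ ⟨b⟩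
    refine Quotient.sound (RelL.relD (relL_of_absorb ?_ ?_) : RelD (a + a * deg b) a)
    · rw [← deg_mul_right, deg_mul]
      exact idem_absorb_right _ _ (deg_idem a) (deg_idem b)
    · rw [← deg_mul_right, deg_deg]

variable (S) in
theorem exists_spined_product :
    ∃ (S₁ S₂ T : RawCRSemiring.{u})
      (φ₁ : S₁.carrier → T.carrier) (φ₂ : S₂.carrier → T.carrier)
      (θ : S → S₁.carrier × S₂.carrier),
      S₁.IsLeftBandOrthoring ∧
      S₂.IsRightBandOrthoring ∧
      T.IsWeakClifford ∧
      IsHom S₁.add S₁.mul T.add T.mul φ₁ ∧ Function.Surjective φ₁ ∧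
      IsHom S₂.add S₂.mul T.add T.mul φ₂ ∧ Function.Surjective φ₂ ∧
      (∀ a : S, φ₁ (θ a).1 = φ₂ (θ a).2) ∧
      Function.Injective θ ∧
      (∀ p : S₁.carrier × S₂.carrier, φ₁ p.1 = φ₂ p.2 → ∃ a : S, θ a = p) ∧
      (∀ a b : S,
        θ (a + b) = (S₁.add (θ a).1 (θ b).1, S₂.add (θ a).2 (θ b).2)) ∧
      (∀ a b : S,
        θ (a * b) = (S₁.mul (θ a).1 (θ b).1, S₂.mul (θ a).2 (θ b).2)) := by
  refine ⟨leftQuotient S, rightQuotient S, cliffordQuotient S,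
    Quotient.map id fun _ _ => RelL.relD, Quotient.map id fun _ _ => RelR.relD,
    fun a => (Quotient.mk _ a, Quotient.mk _ a), leftQuotient_isLeftBandOrthoring,
    rightQuotient_isRightBandOrthoring, cliffordQuotient_isWeakClifford,
    ⟨?_, ?_⟩, ?_, ⟨?_, ?_⟩, ?_, fun _ => rfl, ?_, ?_, fun _ _ => rfl, fun _ _ => rfl⟩
  · rintro ⟨a⟩ ⟨b⟩; rfl
  · rintro ⟨a⟩ ⟨b⟩; rfl
  · rintro ⟨a⟩; exact ⟨Quotient.mk _ a, rfl⟩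
  · rintro ⟨a⟩ ⟨b⟩; rfl
  · rintro ⟨a⟩ ⟨b⟩; rfl
  · rintro ⟨a⟩; exact ⟨Quotient.mk _ a, rfl⟩
  · intro a b h
    exact RelL.eq_of_relR (Quotient.exact (congrArg Prod.fst h))
      (Quotient.exact (congrArg Prod.snd h))
  · rintro ⟨⟨a⟩, ⟨b⟩⟩ h
    obtain ⟨c, h1, h2⟩ : RelD a b := Quotient.exact h
    exact ⟨c, Prod.ext (Quotient.sound h1.symm) (Quotient.sound h2)⟩

end BandOrthoring

/-- Every band orthoring is a spined product of a left band
orthoring and a right band orthoring with respect to a weak Clifford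
semiring. -/
theorem band_orthorings_stmt17
    {S : Type u} [Add S] [Mul S] (inv : S → S)
    (add_assoc : ∀ a b c : S, a + b + c = a + (b + c))
    (mul_assoc : ∀ a b c : S, a * b * c = a * (b * c))
    (left_distrib : ∀ a b c : S, a * (b + c) = a * b + a * c)
    (right_distrib : ∀ a b c : S, (a + b) * c = a * c + b * c)
    (cr1 : ∀ x : S, x + inv x + x = x)
    (cr2 : ∀ x : S, x + inv x = inv x + x)
    (cr3 : ∀ x : S, inv (inv x) = x)
    (cr4 : ∀ x y : S,
      x + (y + inv y) + (x + inv x) + y = (x + inv x) + y + x + (y + inv y))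
    (cr5 : ∀ x : S, x * (x + inv x) = x + inv x)
    -- S is a band orthoring:
    (ortho : ∀ e f : S, e + e = e → f + f = f →
      ((e + f) + (e + f) = e + f ∧ (e * f) + (e * f) = e * f))
    (band : ∀ e f : S, e + e = e → f + f = f →
      (e + e * f + e = e ∧ e + f * e + e = e)) :
    -- then S is a spined product of a left band orthoring and a right band
    -- orthoring with respect to a weak Clifford semiring
    ∃ (S₁ S₂ T : RawCRSemiring.{u})
      (φ₁ : S₁.carrier → T.carrier) (φ₂ : S₂.carrier → T.carrier)
      (θ : S → S₁.carrier × S₂.carrier),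
      S₁.IsLeftBandOrthoring ∧
      S₂.IsRightBandOrthoring ∧
      T.IsWeakClifford ∧
      IsHom S₁.add S₁.mul T.add T.mul φ₁ ∧ Function.Surjective φ₁ ∧
      IsHom S₂.add S₂.mul T.add T.mul φ₂ ∧ Function.Surjective φ₂ ∧
      (∀ a : S, φ₁ (θ a).1 = φ₂ (θ a).2) ∧
      Function.Injective θ ∧
      (∀ p : S₁.carrier × S₂.carrier, φ₁ p.1 = φ₂ p.2 → ∃ a : S, θ a = p) ∧
      (∀ a b : S,
        θ (a + b) = (S₁.add (θ a).1 (θ b).1, S₂.add (θ a).2 (θ b).2)) ∧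
      (∀ a b : S,
        θ (a * b) = (S₁.mul (θ a).1 (θ b).1, S₂.mul (θ a).2 (θ b).2)) := by
  let _ : BandOrthoring S :=
    { add_assoc, mul_assoc, left_distrib, right_distrib
      pinv := inv
      add_pinv_add := cr1
      add_pinv_comm := cr2
      pinv_pinv := cr3
      add_zero_swap := cr4
      mul_add_pinv := cr5
      idem_add := fun e f he hf => (ortho e f he hf).1
      idem_mul := fun e f he hf => (ortho e f he hf).2
      idem_absorb_right := fun e f he hf => (band e f he hf).1
      idem_absorb_left := fun e f he hf => (band e f he hf).2 }
  exact BandOrthoring.exists_spined_product S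
end
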